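/- arXiv:2203.13128 — 2 statements merged into one kernel-verified Lean document; each statement's English description precedes it below -/
import Mathlib

section
/- For every p ∈ (1,∞), the set A_p = {F ∈ SB : the Banach space F admits an equivalent p-AUS norm} is Σ¹₁-hard: for every analytic subset B of the Baire space ℕ^ℕ there exists a Borel measurable map f : ℕ^ℕ → SB with f⁻¹(A_p) = B. -/
open Metric Set Topology Filter

noncomputable def rhoN (X : Type*) [NormedAddCommGroup X] [NormedSpace ℝ X]
    (N : X → ℝ) (τ : ℝ) : ℝ :=
  letI := Classical.propDecidable (FiniteDimensional ℝ X)
  if FiniteDimensional ℝ X then 0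
  else
    sSup { r : ℝ | ∃ y : X, N y ≤ 1 ∧
      r = sInf { s : ℝ | ∃ E : Submodule ℝ X, IsClosed (E : Set X) ∧
            FiniteDimensional ℝ (X ⧸ E) ∧
            s = sSup { t : ℝ | ∃ x ∈ E, N x ≤ 1 ∧ t = N (y + τ • x) - 1 } } }

noncomputable def rho (X : Type*) [NormedAddCommGroup X] [NormedSpace ℝ X] (τ : ℝ) : ℝ :=
  rhoN X (fun x => ‖x‖) τ

def IsNormFn (X : Type*) [NormedAddCommGroup X] [NormedSpace ℝ X] (N : X → ℝ) : Prop :=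
  (∀ x : X, 0 ≤ N x) ∧ (∀ x : X, N x = 0 ↔ x = 0) ∧
    (∀ (a : ℝ) (x : X), N (a • x) = |a| * N x) ∧ ∀ x y : X, N (x + y) ≤ N x + N y

def IsEquivNorm (X : Type*) [NormedAddCommGroup X] [NormedSpace ℝ X] (N : X → ℝ) : Prop :=
  IsNormFn X N ∧ ∃ a > 0, ∃ b > 0, ∀ x : X, a * ‖x‖ ≤ N x ∧ N x ≤ b * ‖x‖

def IsPAUSNorm (X : Type*) [NormedAddCommGroup X] [NormedSpace ℝ X] (N : X → ℝ) (p : ℝ) : Prop :=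
  ∃ C > 0, ∀ τ : ℝ, 0 ≤ τ → rhoN X N τ ≤ C * τ ^ p

def PAUSable (p : ℝ) (X : Type*) [NormedAddCommGroup X] [NormedSpace ℝ X] : Prop :=
  ∃ N : X → ℝ, IsEquivNorm X N ∧ IsPAUSNorm X N p

def IsomToClosedSubspace (Y U : Type*) [NormedAddCommGroup Y] [NormedSpace ℝ Y]
    [NormedAddCommGroup U] [NormedSpace ℝ U] : Prop :=
  ∃ T : Y →L[ℝ] U, Function.Injective T ∧ ∃ c > 0, ∀ y : Y, c * ‖y‖ ≤ ‖T y‖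

def IsQuotientOf (Y U : Type*) [NormedAddCommGroup Y] [NormedSpace ℝ Y]
    [NormedAddCommGroup U] [NormedSpace ℝ U] : Prop :=
  ∃ Q : U →L[ℝ] Y, Function.Surjective Q


/-- The Cantor space `Δ = {0,1}^ℕ`. -/
abbrev CantorSpace : Type := ℕ → Bool

/-- The Banach space `C(Δ)` of continuous real functions on the Cantor space, with the
supremum norm. -/
abbrev CDelta : Type := C(CantorSpace, ℝ)

/-- The standard Borel space `SB` of all closed linear subspaces of `C(Δ)`. -/
def SB : Type := { F : Submodule ℝ CDelta // IsClosed ((F : Submodule ℝ CDelta) : Set CDelta) }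

/-- The Effros–Borel σ-algebra on `SB`, generated by the sets `{F : F ∩ U ≠ ∅}` for `U` open. -/
instance : MeasurableSpace SB :=
  MeasurableSpace.generateFrom
    { A : Set SB | ∃ U : Set CDelta, IsOpen U ∧
        A = { F : SB | (((F.1 : Submodule ℝ CDelta) : Set CDelta) ∩ U).Nonempty } }

open scoped ENNReal

/-- The number of elements of `A` that are at most `n`: the index of the interval containing `n`
when `ℕ` is cut at the points of `A`. -/
def cutIndex (A : Finset ℕ) (n : ℕ) : ℕ := (A.filter (· ≤ n)).card

lemma cutIndex_le_card (A : Finset ℕ) (n : ℕ) : cutIndex A n ≤ A.card :=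
  Finset.card_filter_le _ _

/-- The part of `u` living on the `j`-th interval of `ℕ` cut at the points of `A`. -/
noncomputable def cutPart (A : Finset ℕ) (j : ℕ) (u : ℕ → ℝ≥0∞) : ℕ → ℝ≥0∞ :=
  {n | cutIndex A n = j}.indicator u

/-- The operator whose least fixed point is the Tsirelson norm of the family `F`. -/
noncomputable def tsirelsonStep (F : Set (Finset ℕ)) :
    ((ℕ → ℝ≥0∞) → ℝ≥0∞) →o ((ℕ → ℝ≥0∞) → ℝ≥0∞) where
  toFun N u := (⨆ i, u i) ⊔
    (2⁻¹ * ⨆ A ∈ F, ∑ j ∈ Finset.range (A.card + 1), N (cutPart A j u))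
  monotone' := by
    intro N N' h u
    refine sup_le_sup le_rfl ?_
    gcongr with A hA j hj
    exact h _

/-- The Tsirelson-type norm on nonnegative sequences associated with a family `F` of finite sets
and the parameter `1/2`. -/
noncomputable def tsirelson (F : Set (Finset ℕ)) : (ℕ → ℝ≥0∞) → ℝ≥0∞ :=
  (tsirelsonStep F).lfp

section Tsirelson

variable {F : Set (Finset ℕ)}

lemma tsirelson_eq (u : ℕ → ℝ≥0∞) :
    tsirelson F u = (⨆ i, u i) ⊔
      (2⁻¹ * ⨆ A ∈ F, ∑ j ∈ Finset.range (A.card + 1), tsirelson F (cutPart A j u)) :=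
  (congrFun (tsirelsonStep F).map_lfp u).symm

lemma le_tsirelson (u : ℕ → ℝ≥0∞) (i : ℕ) : u i ≤ tsirelson F u := by
  rw [tsirelson_eq]
  exact (le_iSup u i).trans le_sup_left

lemma sum_cutPart_le {A : Finset ℕ} (hA : A ∈ F) (u : ℕ → ℝ≥0∞) :
    ∑ j ∈ Finset.range (A.card + 1), tsirelson F (cutPart A j u) ≤ 2 * tsirelson F u := by
  have h : 2⁻¹ * ∑ j ∈ Finset.range (A.card + 1), tsirelson F (cutPart A j u)
      ≤ tsirelson F u := by
    rw [tsirelson_eq u]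
    refine le_trans ?_ le_sup_right
    gcongr
    exact le_iSup₂ (f := fun A (_ : A ∈ F) =>
      ∑ j ∈ Finset.range (A.card + 1), tsirelson F (cutPart A j u)) A hA
  calc _ = 2 * (2⁻¹ * ∑ j ∈ Finset.range (A.card + 1), tsirelson F (cutPart A j u)) := by
        rw [← mul_assoc, ENNReal.mul_inv_cancel (by simp) (by simp), one_mul]
    _ ≤ _ := by gcongr

lemma tsirelson_mono : Monotone (tsirelson F) := by
  refine (tsirelsonStep F).lfp_induction (p := Monotone) ?_ ?_
  · intro N hN _ u v huv
    refine sup_le_sup (iSup_mono huv) ?_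
    gcongr with A hA j hj
    exact hN (Set.indicator_mono huv)
  · intro S hS u v huv
    simp only [sSup_apply]
    exact iSup_mono fun N => hS N N.2 huv

lemma tsirelson_add_le (u v : ℕ → ℝ≥0∞) :
    tsirelson F (u + v) ≤ tsirelson F u + tsirelson F v := by
  refine (tsirelsonStep F).lfp_induction (p := fun N => ∀ u v, N (u + v) ≤ N u + N v) ?_ ?_ u v
  · intro N hN _ u v
    refine sup_le ?_ ?_
    · exact iSup_le fun i => add_le_add ((le_iSup u i).trans le_sup_left)
        ((le_iSup v i).trans le_sup_left)
    · refine le_trans ?_ (add_le_add le_sup_right le_sup_right)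
      rw [← mul_add]
      gcongr
      refine iSup₂_le fun A hA => ?_
      calc _ ≤ ∑ j ∈ Finset.range (A.card + 1), (N (cutPart A j u) + N (cutPart A j v)) := by
            gcongr with j hj
            rw [cutPart, Set.indicator_add']
            exact hN _ _
        _ ≤ _ := by
            rw [Finset.sum_add_distrib]
            exact add_le_add
              (le_iSup₂ (f := fun A (_ : A ∈ F) =>
                ∑ j ∈ Finset.range (A.card + 1), N (cutPart A j u)) A hA)
              (le_iSup₂ (f := fun A (_ : A ∈ F) =>
                ∑ j ∈ Finset.range (A.card + 1), N (cutPart A j v)) A hA)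
  · intro S hS u v
    simp only [sSup_apply]
    refine iSup_le fun N => (hS N N.2 u v).trans ?_
    exact add_le_add (le_iSup (fun M : S => M.1 u) N) (le_iSup (fun M : S => M.1 v) N)

lemma cutPart_smul (A : Finset ℕ) (j : ℕ) (c : ℝ≥0∞) (u : ℕ → ℝ≥0∞) :
    cutPart A j (c • u) = c • cutPart A j u := by
  ext i
  simp [cutPart, Set.indicator_apply]

lemma tsirelson_smul_le (c : ℝ≥0∞) (u : ℕ → ℝ≥0∞) :
    tsirelson F (c • u) ≤ c * tsirelson F u := by
  refine (tsirelsonStep F).lfp_induction (p := fun N => ∀ u, N (c • u) ≤ c * N u) ?_ ?_ u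
  · intro N hN _ u
    refine sup_le ?_ ?_
    · exact iSup_le fun i => by
        simp only [Pi.smul_apply, smul_eq_mul]
        gcongr
        exact (le_iSup u i).trans le_sup_left
    · have : c * (2⁻¹ * ⨆ A ∈ F, ∑ j ∈ Finset.range (A.card + 1), N (cutPart A j u))
          ≤ c * (tsirelsonStep F) N u := by
        gcongr
        exact le_sup_right
      refine le_trans ?_ this
      rw [mul_left_comm]
      gcongr
      refine iSup₂_le fun A hA => ?_
      calc _ ≤ ∑ j ∈ Finset.range (A.card + 1), c * N (cutPart A j u) := by
            gcongr with j hj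
            rw [cutPart_smul]
            exact hN _
        _ ≤ _ := by
            rw [← Finset.mul_sum]
            gcongr
            exact le_iSup₂ (f := fun A (_ : A ∈ F) =>
                ∑ j ∈ Finset.range (A.card + 1), N (cutPart A j u)) A hA
  · intro S hS u
    simp only [sSup_apply]
    refine iSup_le fun N => (hS N N.2 u).trans ?_
    gcongr
    exact le_iSup (fun M : S => M.1 u) N

lemma tsirelson_sum_le {ι : Type*} (s : Finset ι) (f : ι → ℕ → ℝ≥0∞) (h0 : tsirelson F 0 = 0) :
    tsirelson F (∑ i ∈ s, f i) ≤ ∑ i ∈ s, tsirelson F (f i) := by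
  classical
  induction s using Finset.induction_on with
  | empty => simp [h0]
  | insert a s ha ih =>
    rw [Finset.sum_insert ha, Finset.sum_insert ha]
    exact (tsirelson_add_le _ _).trans (by gcongr)

lemma sum_cutPart_tsum (A : Finset ℕ) (u : ℕ → ℝ≥0∞) :
    ∑ j ∈ Finset.range (A.card + 1), ∑' i, cutPart A j u i = ∑' i, u i := by
  rw [← Summable.tsum_finsetSum fun _ _ => ENNReal.summable]
  refine tsum_congr fun i => ?_
  rw [Finset.sum_eq_single (cutIndex A i)]
  · simp [cutPart]
  · intro j _ hj
    simp [cutPart, hj.symm]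
  · intro h
    exact absurd (Finset.mem_range.2 (Nat.lt_succ_of_le (cutIndex_le_card A i))) h

lemma tsirelson_le_tsum (u : ℕ → ℝ≥0∞) : tsirelson F u ≤ ∑' i, u i := by
  refine (tsirelsonStep F).lfp_le (a := fun u => ∑' i, u i) ?_ u
  intro u
  refine sup_le (iSup_le fun i => ENNReal.le_tsum i) ?_
  calc _ ≤ 2⁻¹ * ∑' i, u i := by
        gcongr
        refine iSup₂_le fun A hA => ?_
        rw [sum_cutPart_tsum]
    _ ≤ 1 * ∑' i, u i := by
        gcongr
        simp
    _ = _ := one_mul _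

lemma tsirelson_zero : tsirelson F 0 = 0 :=
  le_antisymm ((tsirelson_le_tsum _).trans (by simp)) bot_le

lemma cutPart_le (A : Finset ℕ) (j : ℕ) (u : ℕ → ℝ≥0∞) : cutPart A j u ≤ u :=
  Set.indicator_le_self' fun _ _ => zero_le

/-- On sequences supported in `[0, n)`, the norm depends on the part of the family consisting of
subsets of `[0, n)`. -/
lemma tsirelson_le_of_local {F' : Set (Finset ℕ)} {n : ℕ}
    (hered : ∀ A ∈ F, ∀ A' ⊆ A, A' ∈ F)
    (hFF' : ∀ A ⊆ Finset.range n, A ∈ F → A ∈ F') {u : ℕ → ℝ≥0∞} (hu : ∀ i, n ≤ i → u i = 0) :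
    tsirelson F u ≤ tsirelson F' u := by
  refine (tsirelsonStep F).lfp_induction
    (p := fun N => ∀ u : ℕ → ℝ≥0∞, (∀ i, n ≤ i → u i = 0) → N u ≤ tsirelson F' u) ?_ ?_ u hu
  · intro N hN _ u hu
    rw [tsirelson_eq]
    refine sup_le_sup le_rfl ?_
    gcongr 2⁻¹ * ?_
    refine iSup₂_le fun A hA => ?_
    set A' := A.filter (· < n) with hA'
    have hA'F : A' ∈ F' := hFF' _ (fun a ha => by simp_all) (hered A hA _ (Finset.filter_subset _ _))
    have hcut : ∀ i < n, cutIndex A i = cutIndex A' i := by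
      intro i hi
      simp only [cutIndex, hA', Finset.filter_filter]
      congr 1
      ext a
      simp only [Finset.mem_filter]
      constructor
      · rintro ⟨h1, h2⟩
        exact ⟨h1, by omega, h2⟩
      · rintro ⟨h1, _, h2⟩
        exact ⟨h1, h2⟩
    have hpart : ∀ j, cutPart A j u = cutPart A' j u := by
      intro j
      ext i
      by_cases hi : i < n
      · simp only [cutPart, Set.indicator_apply, mem_ofPred_eq, hcut i hi]
      · simp [cutPart, Set.indicator_apply, hu i (not_lt.1 hi)]
    have hcard : A'.card ≤ A.card := Finset.card_filter_le _ _
    calc ∑ j ∈ Finset.range (A.card + 1), N (cutPart A j u)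
        ≤ ∑ j ∈ Finset.range (A.card + 1), tsirelson F' (cutPart A' j u) := by
          gcongr with j hj
          rw [hpart j]
          refine hN _ fun i hi => ?_
          exact le_antisymm ((cutPart_le A' j u i).trans (hu i hi).le) bot_le
      _ = ∑ j ∈ Finset.range (A'.card + 1), tsirelson F' (cutPart A' j u) := by
          symm
          refine Finset.sum_subset (Finset.range_mono (by omega)) fun j _ hj => ?_
          have : cutPart A' j u = 0 := by
            ext i
            have := cutIndex_le_card A' i
            have hij : cutIndex A' i ≠ j := by
              simp only [Finset.mem_range] at hj
              omega
            simp [cutPart, hij]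
          rw [this, tsirelson_zero]
      _ ≤ _ := le_iSup₂ (f := fun A (_ : A ∈ F') =>
                ∑ j ∈ Finset.range (A.card + 1), tsirelson F' (cutPart A j u)) A' hA'F
  · intro S hS u hu
    simp only [sSup_apply]
    exact iSup_le fun N => hS N N.2 u hu

end Tsirelson

/-- A finitely supported convex weight on `L`. -/
structure IsConvexWeight (L : Set ℕ) (c : ℕ → ℝ≥0∞) : Prop where
  bounded : ∃ n, ∀ i, n ≤ i → c i = 0
  supported : ∀ i, i ∉ L → c i = 0
  tsum_eq : ∑' i, c i = 1

lemma isConvexWeight_single {L : Set ℕ} {l : ℕ} (hl : l ∈ L) :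
    IsConvexWeight L (Pi.single l 1) where
  bounded := ⟨l + 1, fun i hi => Pi.single_eq_of_ne (by omega) _⟩
  supported i hi := Pi.single_eq_of_ne (fun h => hi (by rwa [h])) _
  tsum_eq := tsum_pi_single l 1

/-- Families of finite sets which are hereditary, spreading and contain the singletons. -/
structure IsRegularFamily (F : Set (Finset ℕ)) : Prop where
  hered : ∀ A ∈ F, ∀ A' ⊆ A, A' ∈ F
  spread : ∀ (J : Finset ℕ) (f g : ℕ → ℕ), Set.InjOn f J → Set.InjOn g J →
    (∀ j ∈ J, f j ≤ g j) → J.image f ∈ F → J.image g ∈ F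
  singleton : ∀ n, {n} ∈ F

/-- Every infinite set carries convex weights that are small on the members of `F` obtained
by adding larger elements to `s`. -/
def HasSmallWeights (F : Set (Finset ℕ)) (s : Finset ℕ) : Prop :=
  ∀ ε : ℝ≥0∞, ε ≠ 0 → ∀ L : Set ℕ, L.Infinite → ∃ c, IsConvexWeight L c ∧
    ∀ A : Finset ℕ, (∀ a ∈ A, ∀ b ∈ s, b < a) → s ∪ A ∈ F → ∑ a ∈ A, c a ≤ ε

namespace IsRegularFamily

variable {F : Set (Finset ℕ)}

lemma insert_mem (hF : IsRegularFamily F) {s A : Finset ℕ} {a m : ℕ} (ham : a ≤ m)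
    (hs : ∀ b ∈ s, b < a) (hA : ∀ x ∈ A, m < x) (h : insert a s ∪ A ∈ F) :
    insert m s ∪ A ∈ F := by
  have ha : a ∉ s := fun h => lt_irrefl _ (hs a h)
  have ha' : a ∉ A := fun h => absurd (hA a h) (by omega)
  have hg : ∀ x ∈ insert a s ∪ A, x ≠ a → (x ∈ s ∧ x < a) ∨ (x ∈ A ∧ m < x) := by
    intro x hx hxa
    simp only [Finset.mem_union, Finset.mem_insert] at hx
    rcases hx with (hx | hx) | hx
    · exact absurd hx hxa
    · exact Or.inl ⟨hx, hs x hx⟩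
    · exact Or.inr ⟨hx, hA x hx⟩
  have := hF.spread (insert a s ∪ A) id (fun x => if x = a then m else x)
    Function.injective_id.injOn ?_ ?_ (by rwa [Finset.image_id])
  · convert this using 1
    ext x
    simp only [Finset.mem_union, Finset.mem_insert, Finset.mem_image]
    constructor
    · rintro ((rfl | hx) | hx)
      · exact ⟨a, by simp, by simp⟩
      · exact ⟨x, by simp [hx], if_neg (fun h : x = a => ha (h ▸ hx))⟩
      · exact ⟨x, by simp [hx], if_neg (fun h : x = a => ha' (h ▸ hx))⟩
    · rintro ⟨y, hy, rfl⟩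
      by_cases hya : y = a
      · simp [hya]
      · rw [if_neg hya]
        simp only [hya, false_or] at hy
        tauto
  · intro x hx y hy hxy
    dsimp only at hxy
    split_ifs at hxy with h1 h2 h2
    · rw [h1, h2]
    · rcases hg y hy h2 with h | h <;> omega
    · rcases hg x hx h1 with h | h <;> omega
    · exact hxy
  · intro x hx
    dsimp only [id]
    split_ifs <;> omega

lemma hasSmallWeights_step (hF : IsRegularFamily F) {s : Finset ℕ}
    (h : ∀ m, (∀ b ∈ s, b < m) → HasSmallWeights F (insert m s)) : HasSmallWeights F s := by
  intro ε hε L hL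
  have hε2 : ε / 2 ≠ 0 := by simp [hε]
  have key : ∀ k : ℕ, ∃ C : ℕ → ℝ≥0∞, (∃ n, ∀ i, n ≤ i → C i = 0) ∧ (∀ i, i ∉ L → C i = 0) ∧
      ∑' i, C i = k ∧ ∀ A : Finset ℕ, (∀ a ∈ A, ∀ b ∈ s, b < a) → s ∪ A ∈ F →
        ∑ a ∈ A, C a ≤ 1 + k * (ε / 2) := by
    intro k
    induction k with
    | zero => exact ⟨0, ⟨0, by simp⟩, by simp, by simp, by simp⟩
    | succ k ih =>
      obtain ⟨C, ⟨n, hn⟩, hCL, hCk, hCA⟩ := ih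
      set m := max n (s.sup id + 1) with hm
      have hsm : ∀ b ∈ s, b < m := fun b hb => by
        have := Finset.le_sup (f := id) hb
        simp only [id] at this
        omega
      obtain ⟨c, hc, hcA⟩ := h m hsm (ε / 2) hε2 (L \ Set.Iic m) (hL.sdiff (Set.finite_Iic m))
      obtain ⟨n', hn'⟩ := hc.bounded
      refine ⟨C + c, ⟨max n n', fun i hi => ?_⟩, fun i hi => ?_, ?_, fun A hA hAF => ?_⟩
      · simp [hn i (by omega), hn' i (by omega)]
      · simp [hCL i hi, hc.supported i (fun h => hi h.1)]
      · simp only [Pi.add_apply]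
        rw [ENNReal.tsum_add, hCk, hc.tsum_eq]
        simp
      · simp only [Pi.add_apply, Finset.sum_add_distrib]
        have hcle : ∑ a ∈ A, c a ≤ 1 := hc.tsum_eq ▸ ENNReal.sum_le_tsum A
        by_cases hex : ∃ a ∈ A, a < n
        · obtain ⟨a, haA, han⟩ := hex
          have h1 : ∑ a ∈ A, c a = ∑ a ∈ A.filter (m < ·), c a := by
            symm
            refine Finset.sum_subset (Finset.filter_subset _ _) fun x hx hx' => ?_
            refine hc.supported x fun hxL => hx' ?_
            simp only [Finset.mem_filter]
            exact ⟨hx, not_le.1 hxL.2⟩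
          have h2 : ∑ a ∈ A, c a ≤ ε / 2 := by
            rw [h1]
            refine hcA _ ?_ (hF.insert_mem (a := a) (by omega) (hA a haA) (by simp) ?_)
            · intro x hx b hb
              simp only [Finset.mem_filter] at hx
              rcases Finset.mem_insert.1 hb with rfl | hb
              · exact hx.2
              · exact hA x hx.1 b hb
            · refine hF.hered _ hAF _ ?_
              intro x hx
              simp only [Finset.mem_union, Finset.mem_insert, Finset.mem_filter] at hx ⊢
              rcases hx with (rfl | hx) | hx
              · exact Or.inr haA
              · exact Or.inl hx
              · exact Or.inr hx.1
          calc _ ≤ (1 + k * (ε / 2)) + ε / 2 := add_le_add (hCA A hA hAF) h2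
            _ = _ := by push_cast; ring
        · push Not at hex
          rw [Finset.sum_eq_zero fun a ha => hn a (hex a ha), zero_add]
          exact hcle.trans le_self_add
  obtain ⟨N, hN⟩ := ENNReal.exists_inv_nat_lt hε2
  have hN0 : (N : ℝ≥0∞) ≠ 0 := fun h => by simp [h] at hN
  obtain ⟨C, ⟨n, hn⟩, hCL, hCk, hCA⟩ := key N
  refine ⟨fun i => (N : ℝ≥0∞)⁻¹ * C i, ⟨⟨n, fun i hi => by simp [hn i hi]⟩,
    fun i hi => by simp [hCL i hi], ?_⟩, fun A hA hAF => ?_⟩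
  · rw [ENNReal.tsum_mul_left, hCk, ENNReal.inv_mul_cancel hN0 (by simp)]
  · rw [← Finset.mul_sum]
    calc _ ≤ (N : ℝ≥0∞)⁻¹ * (1 + N * (ε / 2)) := by gcongr; exact hCA A hA hAF
      _ = (N : ℝ≥0∞)⁻¹ + ε / 2 := by
        rw [mul_add, mul_one, ← mul_assoc, ENNReal.inv_mul_cancel hN0 (by simp), one_mul]
      _ ≤ ε / 2 + ε / 2 := by gcongr
      _ = ε := ENNReal.add_halves ε

/-- Pták's combinatorial lemma for regular families without infinite branches. -/
lemma exists_small_weight (hF : IsRegularFamily F)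
    (wf : ∀ M : Set ℕ, M.Infinite → ∃ A : Finset ℕ, ↑A ⊆ M ∧ A ∉ F)
    {ε : ℝ≥0∞} (hε : ε ≠ 0) {L : Set ℕ} (hL : L.Infinite) :
    ∃ c, IsConvexWeight L c ∧ ∀ A ∈ F, ∑ a ∈ A, c a ≤ ε := by
  suffices H : HasSmallWeights F ∅ by
    obtain ⟨c, hc, hcA⟩ := H ε hε L hL
    exact ⟨c, hc, fun A hA => hcA A (by simp) (by simpa using hA)⟩
  by_contra hbad
  have hmem : ∀ s, ¬ HasSmallWeights F s → s ∈ F := by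
    intro s hs
    by_contra hsF
    refine hs fun ε _ L hL => ?_
    obtain ⟨l, hl⟩ := hL.nonempty
    exact ⟨_, isConvexWeight_single hl, fun A _ hA =>
      absurd (hF.hered _ hA s Finset.subset_union_left) hsF⟩
  have hstep : ∀ s : {s // ¬ HasSmallWeights F s}, ∃ m, (∀ b ∈ s.1, b < m) ∧
      ¬ HasSmallWeights F (insert m s.1) := by
    intro s
    by_contra hcon
    push Not at hcon
    exact s.2 (hF.hasSmallWeights_step hcon)
  choose m hm hm' using hstep
  let S : ℕ → {s // ¬ HasSmallWeights F s} :=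
    fun k => Nat.rec (motive := fun _ => {s // ¬ HasSmallWeights F s}) ⟨∅, hbad⟩ (fun _ s => ⟨insert (m s) s.1, hm' s⟩) k
  have hS : ∀ k, (S (k + 1)).1 = insert (m (S k)) (S k).1 := fun k => rfl
  have hmono : Monotone fun k => (S k).1 :=
    monotone_nat_of_le_succ fun k => by
      rw [hS]
      exact Finset.subset_insert _ _
  have hcard : ∀ k, (S k).1.card = k := by
    intro k
    induction k with
    | zero => rfl
    | succ k ih =>
      rw [hS, Finset.card_insert_of_notMem fun h => lt_irrefl _ (hm _ _ h), ih]
  have hinf : (⋃ k, ((S k).1 : Set ℕ)).Infinite := by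
    intro hfin
    have := Finset.card_le_card (s := (S (hfin.toFinset.card + 1)).1) (t := hfin.toFinset)
      (fun x hx => hfin.mem_toFinset.2 (Set.mem_iUnion.2 ⟨hfin.toFinset.card + 1, hx⟩))
    have hk := hcard (hfin.toFinset.card + 1)
    omega
  obtain ⟨A, hAM, hAF⟩ := wf _ hinf
  have : ∀ a ∈ A, ∃ k, a ∈ (S k).1 := fun a ha => by simpa using hAM ha
  choose! k hk using this
  refine hAF (hF.hered _ (hmem _ (S (A.sup k)).2) A fun a ha => ?_)
  exact hmono (Finset.le_sup ha) (hk a ha)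

end IsRegularFamily

lemma cutPart_sum {ι : Type*} (A : Finset ℕ) (i : ℕ) (s : Finset ι) (f : ι → ℕ → ℝ≥0∞) :
    cutPart A i (∑ j ∈ s, f j) = ∑ j ∈ s, cutPart A i (f j) := by
  ext n
  simp only [cutPart, Set.indicator_apply, Finset.sum_apply]
  split_ifs <;> simp

lemma sum_cutPart_le_of_unsplit {F : Set (Finset ℕ)} {A : Finset ℕ} {v : ℕ → ℝ≥0∞} {α β : ℕ}
    (hv : ∀ i, v i ≠ 0 → α < i ∧ i ≤ β) (hA : ∀ a ∈ A, ¬ (α < a ∧ a ≤ β)) :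
    ∑ i ∈ Finset.range (A.card + 1), tsirelson F (cutPart A i v) ≤ tsirelson F v := by
  have hcut : ∀ i, v i ≠ 0 → cutIndex A i = cutIndex A α := by
    intro i hi
    obtain ⟨h1, h2⟩ := hv i hi
    simp only [cutIndex]
    congr 1
    refine Finset.filter_congr fun a ha => ?_
    have := hA a ha
    omega
  rw [Finset.sum_eq_single (cutIndex A α)]
  · exact tsirelson_mono (cutPart_le _ _ _)
  · intro j _ hj
    have : cutPart A j v = 0 := by
      ext i
      by_cases hi : v i = 0
      · simp [cutPart, hi]
      · simp [cutPart, hcut i hi, hj.symm]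
    rw [this, tsirelson_zero]
  · intro h
    exact absurd (Finset.mem_range.2 (Nat.lt_succ_of_le (cutIndex_le_card A α))) h

/-- A Tsirelson norm associated with a regular family without infinite branches is not equivalent
to the `ℓ₁` norm on any subsequence of the unit vector basis. -/
lemma exists_tsirelson_le {F : Set (Finset ℕ)} (hF : IsRegularFamily F)
    (wf : ∀ M : Set ℕ, M.Infinite → ∃ A : Finset ℕ, ↑A ⊆ M ∧ A ∉ F)
    {M : Set ℕ} (hM : M.Infinite) {δ : ℝ≥0∞} (hδ : δ ≠ 0) :
    ∃ u, IsConvexWeight M u ∧ tsirelson F u ≤ δ := by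
  set lam : ℕ → ℝ≥0∞ := fun n => ⨅ u, ⨅ _ : IsConvexWeight (M \ Set.Iic n) u, tsirelson F u
    with hlam
  set Λ : ℝ≥0∞ := ⨆ n, lam n with hΛ
  have hlam_le : ∀ n u, IsConvexWeight (M \ Set.Iic n) u → lam n ≤ tsirelson F u :=
    fun n u hu => iInf₂_le (f := fun u (_ : IsConvexWeight (M \ Set.Iic n) u) => tsirelson F u) u hu
  have hlam1 : ∀ n, lam n ≤ 1 := by
    intro n
    obtain ⟨l, hl⟩ := (hM.sdiff (Set.finite_Iic n)).nonempty
    have := isConvexWeight_single hl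
    exact (hlam_le n _ this).trans ((tsirelson_le_tsum _).trans this.tsum_eq.le)
  have hΛ1 : Λ ≤ 1 := iSup_le hlam1
  have hΛtop : Λ ≠ ⊤ := ne_top_of_le_ne_top ENNReal.one_ne_top hΛ1
  have hnear : ∀ η, Λ < η → ∀ n, ∃ u, IsConvexWeight (M \ Set.Iic n) u ∧ tsirelson F u < η := by
    intro η hη n
    have : lam n < η := (le_iSup lam n).trans_lt hη
    simpa only [hlam, iInf_lt_iff, exists_prop] using this
  by_cases hΛ0 : Λ = 0
  · obtain ⟨u, hu, hu'⟩ := hnear δ (by rw [hΛ0]; exact pos_iff_ne_zero.2 hδ) 0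
    exact ⟨u, ⟨hu.bounded, fun i hi => hu.supported i fun h => hi h.1, hu.tsum_eq⟩, hu'.le⟩
  exfalso
  lift Λ to NNReal using hΛtop with Λ' hΛ'
  have hΛpos : 0 < Λ' := by
    rw [pos_iff_ne_zero]
    simpa using hΛ0
  obtain ⟨n, hn⟩ : ∃ n, ((7 / 8 * Λ' : NNReal) : ℝ≥0∞) < lam n := by
    rw [← lt_iSup_iff, ← hΛ]
    rw [ENNReal.coe_lt_coe]
    rw [← NNReal.coe_lt_coe]
    push_cast
    have : (0 : ℝ) < Λ' := hΛpos
    linarith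
  set μ : NNReal := 5 / 4 * Λ' with hμ
  have hΛμ : (Λ' : ℝ≥0∞) < μ := by
    rw [ENNReal.coe_lt_coe, ← NNReal.coe_lt_coe, hμ]
    push_cast
    have : (0 : ℝ) < Λ' := hΛpos
    linarith
  choose v hv hvμ using hnear μ hΛμ
  choose bd hbd using fun k => (hv k).bounded
  let β : ℕ → ℕ := fun j => Nat.rec (motive := fun _ => ℕ) n (fun _ b => max (bd b) (b + 1)) j
  have hβ : ∀ j, β (j + 1) = max (bd (β j)) (β j + 1) := fun j => rfl
  have hβ0 : β 0 = n := rfl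
  have hβmono : StrictMono β := strictMono_nat_of_lt_succ fun j => by
    rw [hβ]
    omega
  have hvsupp : ∀ j i, v (β j) i ≠ 0 → β j < i ∧ i ≤ β (j + 1) := by
    intro j i hi
    constructor
    · by_contra h
      exact hi ((hv (β j)).supported i fun h' => h'.2 (not_lt.1 h))
    · by_contra h
      refine hi (hbd _ i ?_)
      rw [hβ] at h
      omega
  set L : Set ℕ := Set.range fun j => β (j + 1) with hL
  have hinj : Function.Injective fun j => β (j + 1) := fun i j hij => by
    have : i + 1 = j + 1 := hβmono.injective hij
    omega
  obtain ⟨c, hc, hcF⟩ := hF.exists_small_weight wf (ε := 4⁻¹) (by simp)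
    (Set.infinite_range_of_injective hinj)
  obtain ⟨J, hJ⟩ := hc.bounded
  have hJ' : ∀ j, J ≤ j → c (β (j + 1)) = 0 := fun j hj => hJ _ (by
    have := hβmono.id_le (j + 1)
    simp only [id] at this
    omega)
  have hcsum : ∑ j ∈ Finset.range J, c (β (j + 1)) = 1 := by
    rw [← hc.tsum_eq, ← hinj.tsum_eq (f := c)]
    · exact (tsum_eq_sum fun j hj => hJ' j (by simpa using hj)).symm
    · intro i hi
      by_contra h
      exact hi (hc.supported i h)
  set w : ℕ → ℝ≥0∞ := ∑ j ∈ Finset.range J, c (β (j + 1)) • v (β j) with hw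
  have hwapp : ∀ i, w i = ∑ j ∈ Finset.range J, c (β (j + 1)) * v (β j) i := fun i => by
    simp [hw, Finset.sum_apply]
  have hwconv : IsConvexWeight (M \ Set.Iic n) w := by
    refine ⟨⟨β J + 1, fun i hi => ?_⟩, fun i hi => ?_, ?_⟩
    · rw [hwapp]
      refine Finset.sum_eq_zero fun j hj => ?_
      by_contra h
      have h1 := (hvsupp j i (right_ne_zero_of_mul h)).2
      have h2 : β (j + 1) ≤ β J := hβmono.monotone (Nat.succ_le_of_lt (Finset.mem_range.1 hj))
      omega
    · rw [hwapp]
      refine Finset.sum_eq_zero fun j hj => ?_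
      rw [(hv (β j)).supported i, mul_zero]
      intro h
      refine hi ⟨h.1, fun h' => h.2 ?_⟩
      have : β 0 ≤ β j := hβmono.monotone (Nat.zero_le _)
      simp only [Set.mem_Iic] at h' ⊢
      omega
    · simp only [hwapp]
      rw [Summable.tsum_finsetSum fun _ _ => ENNReal.summable]
      rw [← hcsum]
      refine Finset.sum_congr rfl fun j _ => ?_
      rw [ENNReal.tsum_mul_left, (hv _).tsum_eq, mul_one]
  have hsup : ∀ i, w i ≤ 4⁻¹ * μ := by
    intro i
    rw [hwapp]
    by_cases hex : ∃ j ∈ Finset.range J, v (β j) i ≠ 0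
    · obtain ⟨j, hj, hji⟩ := hex
      rw [Finset.sum_eq_single_of_mem j hj]
      · gcongr
        · simpa using hcF {β (j + 1)} (hF.singleton _)
        · exact (le_tsirelson _ _).trans (hvμ _).le
      · intro k _ hkj
        by_contra h
        have h1 := hvsupp k i (right_ne_zero_of_mul h)
        have h2 := hvsupp j i hji
        rcases lt_or_gt_of_ne hkj with h3 | h3
        · have : β (k + 1) ≤ β j := hβmono.monotone h3
          omega
        · have : β (j + 1) ≤ β k := hβmono.monotone h3
          omega
    · push Not at hex
      rw [Finset.sum_eq_zero fun j hj => by rw [hex j hj, mul_zero]]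
      exact bot_le
  have hadm : ∀ A ∈ F, ∑ i ∈ Finset.range (A.card + 1), tsirelson F (cutPart A i w)
      ≤ (1 + 4⁻¹) * μ := by
    classical
    intro A hA
    obtain ⟨Sp, hSp⟩ : ∃ Sp : Finset ℕ, ∀ j, j ∈ Sp ↔
        j ∈ Finset.range J ∧ ∃ a ∈ A, β j < a ∧ a ≤ β (j + 1) :=
      ⟨((Finset.range J).finite_toSet.sep fun j => ∃ a ∈ A, β j < a ∧ a ≤ β (j + 1)).toFinset,
        fun j => by simp⟩
    have hSpc : ∑ j ∈ Sp, c (β (j + 1)) ≤ 4⁻¹ := by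
      have hex : ∀ j ∈ Sp, ∃ a ∈ A, β j < a ∧ a ≤ β (j + 1) := fun j hj =>
        ((hSp j).1 hj).2
      choose! g hgA hg1 hg2 using hex
      have hginj : Set.InjOn g Sp := by
        intro j hj k hk hjk
        by_contra hne
        have a1 := hg1 j hj
        have a2 := hg2 j hj
        have a3 := hg1 k hk
        have a4 := hg2 k hk
        rcases lt_or_gt_of_ne hne with h3 | h3
        · have : β (j + 1) ≤ β k := hβmono.monotone h3
          omega
        · have : β (k + 1) ≤ β j := hβmono.monotone h3
          omega
      have hmem : Sp.image (fun j => β (j + 1)) ∈ F :=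
        hF.spread Sp g _ hginj hinj.injOn hg2 (hF.hered A hA _ (by
          intro x hx
          obtain ⟨j, hj, rfl⟩ := Finset.mem_image.1 hx
          exact hgA j hj))
      have := hcF _ hmem
      rwa [Finset.sum_image hinj.injOn] at this
    have hone : ∀ j, ∑ i ∈ Finset.range (A.card + 1), tsirelson F (cutPart A i (v (β j)))
        ≤ 2 * μ := fun j =>
      (sum_cutPart_le hA _).trans (by gcongr; exact (hvμ _).le)
    have hone' : ∀ j ∈ Finset.range J, j ∉ Sp →
        ∑ i ∈ Finset.range (A.card + 1), tsirelson F (cutPart A i (v (β j))) ≤ μ := by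
      intro j hj hjS
      refine (sum_cutPart_le_of_unsplit (hvsupp j) fun a ha h => hjS ?_).trans (hvμ _).le
      exact (hSp j).2 ⟨hj, a, ha, h⟩
    calc ∑ i ∈ Finset.range (A.card + 1), tsirelson F (cutPart A i w)
        ≤ ∑ i ∈ Finset.range (A.card + 1), ∑ j ∈ Finset.range J,
            c (β (j + 1)) * tsirelson F (cutPart A i (v (β j))) := by
          gcongr with i _
          rw [hw, cutPart_sum]
          refine (tsirelson_sum_le _ _ tsirelson_zero).trans ?_
          gcongr with j _
          rw [cutPart_smul]
          exact tsirelson_smul_le _ _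
      _ = ∑ j ∈ Finset.range J, c (β (j + 1)) *
            ∑ i ∈ Finset.range (A.card + 1), tsirelson F (cutPart A i (v (β j))) := by
          rw [Finset.sum_comm]
          simp only [Finset.mul_sum]
      _ ≤ ∑ j ∈ Finset.range J, (c (β (j + 1)) * μ + if j ∈ Sp then c (β (j + 1)) * μ else 0) := by
          gcongr with j hj
          split_ifs with hjS
          · rw [← mul_add, ← two_mul]
            gcongr
            exact hone j
          · rw [add_zero]
            gcongr
            exact hone' j hj hjS
      _ = (∑ j ∈ Finset.range J, c (β (j + 1))) * μ + (∑ j ∈ Sp, c (β (j + 1))) * μ := by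
          rw [Finset.sum_add_distrib, Finset.sum_mul, Finset.sum_mul]
          congr 1
          rw [Finset.sum_ite_mem, Finset.inter_eq_right.2 fun j hj => ((hSp j).1 hj).1]
      _ ≤ 1 * μ + 4⁻¹ * μ := by
          rw [hcsum]
          gcongr
      _ = _ := by ring
  have hTw : tsirelson F w ≤ ((5 / 8 * μ : NNReal) : ℝ≥0∞) := by
    rw [tsirelson_eq]
    have e1 : ((4⁻¹ : NNReal) : ℝ≥0∞) = 4⁻¹ := by
      rw [ENNReal.coe_inv (by norm_num)]
      rfl
    have e2 : ((2⁻¹ : NNReal) : ℝ≥0∞) = 2⁻¹ := by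
      rw [ENNReal.coe_inv (by norm_num)]
      rfl
    refine sup_le (iSup_le fun i => (hsup i).trans ?_) ?_
    · rw [← e1, ← ENNReal.coe_mul, ENNReal.coe_le_coe]
      gcongr
      rw [← NNReal.coe_le_coe]
      push_cast
      norm_num
    · calc _ ≤ 2⁻¹ * ((1 + 4⁻¹) * (μ : ℝ≥0∞)) := by
            gcongr
            exact iSup₂_le hadm
        _ = _ := by
            rw [← e1, ← e2, ← ENNReal.coe_one, ← ENNReal.coe_add, ← ENNReal.coe_mul,
              ← ENNReal.coe_mul, ENNReal.coe_inj, ← NNReal.coe_inj]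
            push_cast
            ring
  have hcontra := (hn.trans_le (hlam_le n w hwconv)).trans_le hTw
  rw [ENNReal.coe_lt_coe, ← NNReal.coe_lt_coe, hμ] at hcontra
  push_cast at hcontra
  have : (0 : ℝ) < Λ' := hΛpos
  linarith

/-- The finite sets which dominate an initial segment of a sequence `y` such that `g y` and `x`
agree on that segment. -/
def dominatingFamily (P : Prop) (g : (ℕ → ℕ) → ℕ → ℕ) (x : ℕ → ℕ) : Set (Finset ℕ) :=
  {A | A.card ≤ 1 ∨ (P ∧ ∃ y : ℕ → ℕ, (∀ i < A.card, g y i = x i) ∧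
    ∀ i < A.card, (A.filter (· < y i)).card ≤ i)}

lemma isRegularFamily_dominatingFamily (P : Prop) (g : (ℕ → ℕ) → ℕ → ℕ) (x : ℕ → ℕ) :
    IsRegularFamily (dominatingFamily P g x) where
  hered := by
    rintro A hA A' hA'
    have hcard := Finset.card_le_card hA'
    rcases hA with hA | ⟨hP, y, hy1, hy2⟩
    · exact Or.inl (hcard.trans hA)
    · exact Or.inr ⟨hP, y, fun i hi => hy1 i (by omega), fun i hi =>
        (Finset.card_le_card (Finset.filter_subset_filter _ hA')).trans (hy2 i (by omega))⟩
  spread := by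
    rintro J f g' hf hg hfg h
    have hcard : (J.image f).card = (J.image g').card := by
      rw [Finset.card_image_of_injOn hf, Finset.card_image_of_injOn hg]
    rcases h with hA | ⟨hP, y, hy1, hy2⟩
    · exact Or.inl (hcard ▸ hA)
    · refine Or.inr ⟨hP, y, fun i hi => hy1 i (by omega), fun i hi => ?_⟩
      refine le_trans ?_ (hy2 i (by omega))
      rw [Finset.filter_image, Finset.filter_image,
        Finset.card_image_of_injOn (hg.mono (Finset.coe_subset.2 (Finset.filter_subset _ _))),
        Finset.card_image_of_injOn (hf.mono (Finset.coe_subset.2 (Finset.filter_subset _ _)))]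
      refine Finset.card_le_card fun j hj => ?_
      simp only [Finset.mem_filter] at hj ⊢
      exact ⟨hj.1, (hfg j hj.1).trans_lt hj.2⟩
  singleton n := Or.inl (by simp)

lemma eventually_mem_dominatingFamily_iff (P : Prop) (g : (ℕ → ℕ) → ℕ → ℕ) (A : Finset ℕ)
    (x : ℕ → ℕ) :
    ∀ᶠ x' in 𝓝 x, (A ∈ dominatingFamily P g x' ↔ A ∈ dominatingFamily P g x) := by
  have : ∀ᶠ x' in 𝓝 x, ∀ i ∈ Finset.range A.card, x' i = x i := by
    rw [Filter.eventually_all_finset]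
    intro i _
    exact (continuous_apply i).continuousAt.eventually_mem ((isOpen_discrete {x i}).mem_nhds rfl)
  filter_upwards [this] with x' hx'
  have hiff : ∀ y : ℕ → ℕ, (∀ i < A.card, g y i = x' i) ↔ (∀ i < A.card, g y i = x i) :=
    fun y => forall₂_congr fun i hi => by rw [hx' i (by simpa using hi)]
  simp only [dominatingFamily, Set.mem_ofPred_eq, hiff]

lemma image_mem_dominatingFamily {P : Prop} (hP : P) (g : (ℕ → ℕ) → ℕ → ℕ) (y : ℕ → ℕ) :
    ∃ b : ℕ → ℕ, StrictMono b ∧ ∀ k, (Finset.range k).image b ∈ dominatingFamily P g (g y) := by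
  refine ⟨fun n => ∑ i ∈ Finset.range (n + 1), (y i + 1), ?_, fun k => Or.inr ⟨hP, y, ?_, ?_⟩⟩
  · refine strictMono_nat_of_lt_succ fun n => ?_
    rw [Finset.sum_range_succ _ (n + 1)]
    omega
  · exact fun _ _ => rfl
  · intro i _
    rw [Finset.filter_image]
    refine Finset.card_image_le.trans ?_
    calc _ ≤ (Finset.range i).card := by
          refine Finset.card_le_card fun j hj => ?_
          simp only [Finset.mem_filter, Finset.mem_range] at hj ⊢
          by_contra hij
          have h1 : y i + 1 ≤ ∑ l ∈ Finset.range (j + 1), (y l + 1) :=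
            Finset.single_le_sum (f := fun l => y l + 1) (fun _ _ => Nat.zero_le _)
              (by simp; omega)
          omega
      _ = i := Finset.card_range i

lemma exists_notMem_dominatingFamily {P : Prop} {g : (ℕ → ℕ) → ℕ → ℕ} (hg : Continuous g)
    {x : ℕ → ℕ} (hx : ¬ (P ∧ x ∈ Set.range g)) {M : Set ℕ} (hM : M.Infinite) :
    ∃ A : Finset ℕ, ↑A ⊆ M ∧ A ∉ dominatingFamily P g x := by
  by_contra hcon
  push Not at hcon
  obtain ⟨e, he, heM⟩ : ∃ e : ℕ → ℕ, StrictMono e ∧ ∀ n, e n ∈ M :=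
    ⟨Nat.nth (· ∈ M), Nat.nth_strictMono hM, fun n => Nat.nth_mem_of_infinite hM n⟩
  have hcard : ∀ k, ((Finset.range k).image e).card = k := fun k => by
    rw [Finset.card_image_of_injective _ he.injective, Finset.card_range]
  have hmem : ∀ k, P ∧ ∃ y : ℕ → ℕ, (∀ i < k + 2, g y i = x i) ∧ ∀ i < k + 2, y i ≤ e i := by
    intro k
    rcases hcon ((Finset.range (k + 2)).image e) (by
      intro a ha
      obtain ⟨i, _, rfl⟩ := by simpa using ha
      exact heM i) with h | ⟨hP, y, hy1, hy2⟩
    · rw [hcard] at h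
      omega
    · rw [hcard] at hy1 hy2
      refine ⟨hP, y, hy1, fun i hi => ?_⟩
      by_contra hlt
      have h1 := hy2 i hi
      have h2 : (Finset.range (i + 1)).image e ⊆
          ((Finset.range (k + 2)).image e).filter (· < y i) := by
        intro a ha
        obtain ⟨j, hj, rfl⟩ := Finset.mem_image.1 ha
        rw [Finset.mem_range] at hj
        refine Finset.mem_filter.2
          ⟨Finset.mem_image_of_mem _ (Finset.mem_range.2 (by omega)), ?_⟩
        have := he.monotone (show j ≤ i by omega)
        omega
      have h3 := Finset.card_le_card h2
      rw [hcard] at h3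
      omega
  choose hP y hy1 hy2 using hmem
  have hcomp : IsCompact (Set.univ.pi fun i => Set.Iic (e i)) :=
    isCompact_univ_pi fun i => (Set.finite_Iic (e i)).isCompact
  set z : ℕ → ℕ → ℕ := fun k i => min (y k i) (e i) with hz
  obtain ⟨y₀, _, φ, hφ, hlim⟩ := hcomp.tendsto_subseq (x := z) fun k i _ => by simp [hz]
  have hlim' : Tendsto (y ∘ φ) atTop (𝓝 y₀) := by
    rw [tendsto_pi_nhds] at hlim ⊢
    intro i
    refine (hlim i).congr' ?_
    filter_upwards [eventually_ge_atTop i] with k hk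
    have : i < φ k + 2 := by
      have := hφ.id_le k
      simp only [id] at this
      omega
    simp [hz, hy2 (φ k) i this]
  refine hx ⟨hP 0, y₀, ?_⟩
  have h1 : Tendsto (fun k => g ((y ∘ φ) k)) atTop (𝓝 (g y₀)) := (hg.tendsto y₀).comp hlim'
  refine tendsto_nhds_unique h1 (tendsto_pi_nhds.2 fun i => ?_)
  refine tendsto_const_nhds.congr' ?_
  filter_upwards [eventually_ge_atTop i] with k hk
  refine (hy1 (φ k) i ?_).symm
  have := hφ.id_le k
  simp only [id] at this
  omega

lemma exists_regular_families {B : Set (ℕ → ℕ)} (hB : MeasureTheory.AnalyticSet B) :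
    ∃ F : (ℕ → ℕ) → Set (Finset ℕ), (∀ x, IsRegularFamily (F x)) ∧
      (∀ A x, ∀ᶠ x' in 𝓝 x, (A ∈ F x' ↔ A ∈ F x)) ∧
      (∀ x ∈ B, ∃ b : ℕ → ℕ, StrictMono b ∧ ∀ k, (Finset.range k).image b ∈ F x) ∧
      (∀ x ∉ B, ∀ M : Set ℕ, M.Infinite → ∃ A : Finset ℕ, ↑A ⊆ M ∧ A ∉ F x) := by
  obtain ⟨P, g, hg, hPg⟩ : ∃ (P : Prop) (g : (ℕ → ℕ) → ℕ → ℕ), Continuous g ∧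
      ∀ x, x ∈ B ↔ P ∧ x ∈ Set.range g := by
    rw [MeasureTheory.AnalyticSet] at hB
    rcases hB with rfl | ⟨g, hg, rfl⟩
    · exact ⟨False, id, continuous_id, by simp⟩
    · exact ⟨True, g, hg, by simp⟩
  refine ⟨dominatingFamily P g, isRegularFamily_dominatingFamily P g,
    eventually_mem_dominatingFamily_iff P g, ?_, ?_⟩
  · intro x hx
    obtain ⟨hP, y, rfl⟩ := (hPg x).1 hx
    exact image_mem_dominatingFamily hP g y
  · intro x hx M hM
    exact exists_notMem_dominatingFamily hg (fun h => hx ((hPg x).2 h)) hM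

section CubeFunctions

variable (F : Set (Finset ℕ))

/-- The point of the Hilbert cube encoded by `ω`, as a sequence of extended nonnegative reals. -/
noncomputable def cubePoint (ω : CantorSpace) (n : ℕ) : ℝ≥0∞ :=
  ENNReal.ofReal (cantorToHilbert ω n)

/-- The norm of the first `n` coordinates of the point of the Hilbert cube encoded by `ω`. -/
noncomputable def headNorm (n : ℕ) (ω : CantorSpace) : ℝ :=
  (tsirelson F ((Set.Iio n).indicator (cubePoint ω))).toReal

/-- The point of the Hilbert cube encoded by `ω`, cut off where its initial segments get
too large. -/
noncomputable def weight (ω : CantorSpace) (n : ℕ) : ℝ :=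
  cantorToHilbert ω n * max 0 (min 1 (2 - headNorm F (n + 1) ω))

variable {F}

lemma tsirelson_indicator_Iio_le (n : ℕ) (u : ℕ → ℝ≥0∞) :
    tsirelson F ((Set.Iio n).indicator u) ≤ ∑ i ∈ Finset.range n, u i := by
  refine (tsirelson_le_tsum _).trans_eq ?_
  rw [tsum_eq_sum (s := Finset.range n)]
  · exact Finset.sum_congr rfl fun i hi => Set.indicator_of_mem (by simpa using hi) _
  · exact fun i hi => Set.indicator_of_notMem (by simpa using hi) _

lemma tsirelson_cubePoint_ne_top (n : ℕ) (ω : CantorSpace) :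
    tsirelson F ((Set.Iio n).indicator (cubePoint ω)) ≠ ⊤ :=
  ne_top_of_le_ne_top (ENNReal.sum_ne_top.2 fun _ _ => ENNReal.ofReal_ne_top)
    (tsirelson_indicator_Iio_le n _)

lemma headNorm_le_add (n : ℕ) (ω ω₀ : CantorSpace) :
    headNorm F n ω ≤ headNorm F n ω₀ +
      ∑ i ∈ Finset.range n, |(cantorToHilbert ω i : ℝ) - cantorToHilbert ω₀ i| := by
  have h : tsirelson F ((Set.Iio n).indicator (cubePoint ω)) ≤
      tsirelson F ((Set.Iio n).indicator (cubePoint ω₀)) +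
      ENNReal.ofReal (∑ i ∈ Finset.range n,
        |(cantorToHilbert ω i : ℝ) - cantorToHilbert ω₀ i|) := by
    rw [ENNReal.ofReal_sum_of_nonneg fun _ _ => abs_nonneg _]
    refine le_trans ?_ ((tsirelson_add_le _ _).trans
      (add_le_add le_rfl (tsirelson_indicator_Iio_le n _)))
    rw [← Set.indicator_add']
    refine tsirelson_mono (Set.indicator_mono fun i => ?_)
    rw [Pi.add_apply, cubePoint, cubePoint,
      ← ENNReal.ofReal_add (cantorToHilbert ω₀ i).2.1 (abs_nonneg _)]
    refine ENNReal.ofReal_le_ofReal ?_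
    linarith [le_abs_self ((cantorToHilbert ω i : ℝ) - cantorToHilbert ω₀ i)]
  have hs : 0 ≤ ∑ i ∈ Finset.range n, |(cantorToHilbert ω i : ℝ) - cantorToHilbert ω₀ i| :=
    Finset.sum_nonneg fun _ _ => abs_nonneg _
  have := ENNReal.toReal_mono
    (ENNReal.add_ne_top.2 ⟨tsirelson_cubePoint_ne_top n ω₀, ENNReal.ofReal_ne_top⟩) h
  rwa [ENNReal.toReal_add (tsirelson_cubePoint_ne_top n ω₀) ENNReal.ofReal_ne_top,
    ENNReal.toReal_ofReal hs] at this

lemma continuous_cantorToHilbert_apply (n : ℕ) :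
    Continuous fun ω : CantorSpace => (cantorToHilbert ω n : ℝ) :=
  continuous_subtype_val.comp ((continuous_apply n).comp cantorToHilbert_continuous)

lemma continuous_headNorm (n : ℕ) : Continuous (headNorm F n) := by
  refine continuous_iff_continuousAt.2 fun ω₀ => ?_
  have hlim : Tendsto (fun ω => ∑ i ∈ Finset.range n,
      |(cantorToHilbert ω i : ℝ) - cantorToHilbert ω₀ i|) (𝓝 ω₀) (𝓝 0) := by
    have : Continuous fun ω => ∑ i ∈ Finset.range n,
        |(cantorToHilbert ω i : ℝ) - cantorToHilbert ω₀ i| :=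
      continuous_finsetSum _ fun i _ =>
        ((continuous_cantorToHilbert_apply i).sub continuous_const).abs
    simpa using this.tendsto ω₀
  rw [ContinuousAt, tendsto_iff_dist_tendsto_zero]
  refine squeeze_zero (fun _ => dist_nonneg) (fun ω => ?_) hlim
  rw [Real.dist_eq, abs_sub_le_iff]
  have h1 := headNorm_le_add (F := F) n ω ω₀
  have h2 := headNorm_le_add (F := F) n ω₀ ω
  simp only [abs_sub_comm (cantorToHilbert ω₀ _ : ℝ)] at h2
  constructor <;> linarith

lemma continuous_weight (n : ℕ) : Continuous fun ω => weight F ω n :=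
  (continuous_cantorToHilbert_apply n).mul
    (continuous_const.max (continuous_const.min (continuous_const.sub (continuous_headNorm _))))

lemma weight_nonneg (ω : CantorSpace) (n : ℕ) : 0 ≤ weight F ω n :=
  mul_nonneg (cantorToHilbert ω n).2.1 (le_max_left _ _)

lemma weight_le (ω : CantorSpace) (n : ℕ) : weight F ω n ≤ cantorToHilbert ω n :=
  mul_le_of_le_one_right (cantorToHilbert ω n).2.1 (max_le zero_le_one (min_le_left _ _))

lemma tsirelson_weight_le (n : ℕ) (ω : CantorSpace) :
    tsirelson F ((Set.Iio n).indicator fun i => ENNReal.ofReal (weight F ω i)) ≤ 2 := by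
  induction n with
  | zero =>
    rw [show Set.Iio 0 = (∅ : Set ℕ) by ext; simp, Set.indicator_empty]
    exact (tsirelson_zero (F := F)).le.trans zero_le
  | succ n ih =>
    by_cases h : headNorm F (n + 1) ω ≤ 2
    · calc _ ≤ tsirelson F ((Set.Iio (n + 1)).indicator (cubePoint ω)) :=
          tsirelson_mono (Set.indicator_mono fun i => ENNReal.ofReal_le_ofReal (weight_le ω i))
        _ ≤ 2 := by
          rw [← ENNReal.ofReal_toReal (tsirelson_cubePoint_ne_top (F := F) (n + 1) ω)]
          exact (ENNReal.ofReal_le_ofReal h).trans (by simp)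
    · refine le_trans (le_of_eq ?_) ih
      congr 1
      ext i
      have hn : weight F ω n = 0 := by
        rw [weight, max_eq_left, mul_zero]
        exact (min_le_right _ _).trans (by linarith)
      rcases lt_trichotomy i n with hi | rfl | hi
      · rw [Set.indicator_of_mem (by simp; omega), Set.indicator_of_mem (by simpa using hi)]
      · simp [hn]
      · rw [Set.indicator_of_notMem (by simp; omega), Set.indicator_of_notMem (by simp; omega)]

/-- Every sequence in the unit ball is of the form `weight F ω`. -/
lemma exists_weight_eq (u : ℕ → ℝ≥0∞) (hu : ∀ n, tsirelson F ((Set.Iio n).indicator u) ≤ 1) :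
    ∃ ω, ∀ n, ENNReal.ofReal (weight F ω n) = u n := by
  have hu1 : ∀ n, u n ≤ 1 := fun n => by
    refine le_trans ?_ ((le_tsirelson _ n).trans (hu (n + 1)))
    rw [Set.indicator_of_mem (by simp)]
  obtain ⟨ω, hω⟩ := cantorToHilbert_surjective fun n =>
    ⟨(u n).toReal, ENNReal.toReal_nonneg, ENNReal.toReal_mono ENNReal.one_ne_top (hu1 n)⟩
  have hcube : cubePoint ω = u := by
    ext n
    rw [cubePoint, hω, ENNReal.ofReal_toReal (ne_top_of_le_ne_top ENNReal.one_ne_top (hu1 n))]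
  refine ⟨ω, fun n => ?_⟩
  have hhead : headNorm F (n + 1) ω ≤ 1 := by
    rw [headNorm, hcube]
    exact ENNReal.toReal_mono ENNReal.one_ne_top (hu (n + 1))
  rw [weight, min_eq_left (by linarith), max_eq_right zero_le_one, mul_one]
  exact congrFun hcube n

/-- The generators of the Banach space associated with the family `F`. -/
noncomputable def cubeFun (F : Set (Finset ℕ)) (r : ℝ) (hr : 0 ≤ r) (n : ℕ) : CDelta where
  toFun ω := weight F ω n ^ r
  continuous_toFun := (continuous_weight n).rpow_const fun _ => Or.inr hr

lemma cubeFun_apply {r : ℝ} (hr : 0 ≤ r) (n : ℕ) (ω : CantorSpace) :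
    cubeFun F r hr n ω = weight F ω n ^ r := rfl

lemma continuous_cubeFun {F : (ℕ → ℕ) → Set (Finset ℕ)} (hF : ∀ x, IsRegularFamily (F x))
    (hloc : ∀ A x, ∀ᶠ x' in 𝓝 x, (A ∈ F x' ↔ A ∈ F x)) {r : ℝ} (hr : 0 ≤ r) (n : ℕ) :
    Continuous fun x => cubeFun (F x) r hr n := by
  refine continuous_iff_continuousAt.2 fun x => ?_
  refine (tendsto_const_nhds (x := cubeFun (F x) r hr n)).congr' ?_
  have : ∀ᶠ x' in 𝓝 x, ∀ A ∈ (Finset.range (n + 1)).powerset, (A ∈ F x' ↔ A ∈ F x) := by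
    rw [Filter.eventually_all_finset]
    exact fun A _ => hloc A x
  filter_upwards [this] with x' hx'
  ext ω
  rw [cubeFun_apply, cubeFun_apply, weight, weight, headNorm, headNorm]
  have hsupp : ∀ i, n + 1 ≤ i → (Set.Iio (n + 1)).indicator (cubePoint ω) i = 0 := fun i hi =>
    Set.indicator_of_notMem (by simpa using hi) _
  rw [le_antisymm
    (tsirelson_le_of_local (hF x).hered
      (fun A hA => (hx' A (Finset.mem_powerset.2 hA)).2) hsupp)
    (tsirelson_le_of_local (hF x').hered
      (fun A hA => (hx' A (Finset.mem_powerset.2 hA)).1) hsupp)]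

/-- The closed linear span of a sequence of functions. -/
def closedSpan (φ : ℕ → CDelta) : SB :=
  ⟨(Submodule.span ℝ (Set.range φ)).topologicalClosure, Submodule.isClosed_topologicalClosure _⟩

lemma measurable_closedSpan {α : Type*} [TopologicalSpace α] [MeasurableSpace α]
    [OpensMeasurableSpace α] {φ : α → ℕ → CDelta} (hφ : ∀ n, Continuous fun x => φ x n) :
    Measurable fun x => closedSpan (φ x) := by
  refine measurable_generateFrom ?_
  rintro _ ⟨U, hU, rfl⟩
  refine IsOpen.measurableSet ?_
  have : (fun x => closedSpan (φ x)) ⁻¹'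
      {F : SB | (((F.1 : Submodule ℝ CDelta) : Set CDelta) ∩ U).Nonempty} =
      ⋃ a : ℕ →₀ ℝ, {x | (a.sum fun n c => c • φ x n) ∈ U} := by
    ext x
    rw [Set.mem_preimage, Set.mem_ofPred_eq, Set.mem_iUnion]
    change (closure (Submodule.span ℝ (Set.range (φ x)) : Set CDelta) ∩ U).Nonempty ↔ _
    rw [closure_inter_open_nonempty_iff hU]
    constructor
    · rintro ⟨z, hz, hzU⟩
      obtain ⟨a, rfl⟩ := Finsupp.mem_span_range_iff_exists_finsupp.1 hz
      exact ⟨a, hzU⟩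
    · rintro ⟨a, ha⟩
      exact ⟨_, Finsupp.mem_span_range_iff_exists_finsupp.2 ⟨a, rfl⟩, ha⟩
  rw [this]
  refine isOpen_iUnion fun a => hU.preimage ?_
  exact continuous_finsetSum _ fun n _ => (hφ n).const_smul (a n)

end CubeFunctions

section BlockNorm

/-- The index of the interval containing `n` when `ℕ` is cut at the points `b i`. -/
noncomputable def blockIndex (b : ℕ → ℕ) (n : ℕ) : ℕ := sInf {m | n < b m}

lemma blockIndex_le_iff {b : ℕ → ℕ} (hb : StrictMono b) {n m : ℕ} :
    blockIndex b n ≤ m ↔ n < b m := by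
  refine ⟨fun h => ?_, fun h => Nat.sInf_le h⟩
  have hne : {m | n < b m}.Nonempty := ⟨n + 1, hb.le_apply (x := n + 1)⟩
  exact (Nat.sInf_mem hne : n < b _).trans_le (hb.monotone h)

/-- The sum of the Tsirelson norms of the blocks of a sequence cut at the points `b i`. -/
noncomputable def blockNorm (F : Set (Finset ℕ)) (b : ℕ → ℕ) (u : ℕ → ℝ≥0∞) : ℝ≥0∞ :=
  ∑' j, tsirelson F ({n | blockIndex b n = j}.indicator u)

variable {F : Set (Finset ℕ)} {b : ℕ → ℕ}

lemma blockNorm_le (hb : StrictMono b) (hF : ∀ k, (Finset.range k).image b ∈ F)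
    (u : ℕ → ℝ≥0∞) : blockNorm F b u ≤ 2 * tsirelson F u := by
  refine ENNReal.tsum_le_of_sum_range_le fun k => ?_
  have hcard : ((Finset.range k).image b).card = k := by
    rw [Finset.card_image_of_injective _ hb.injective, Finset.card_range]
  have hcut : ∀ n, cutIndex ((Finset.range k).image b) n = min k (blockIndex b n) := by
    intro n
    rw [cutIndex, Finset.filter_image, Finset.card_image_of_injective _ hb.injective,
      ← Finset.card_range (min k (blockIndex b n))]
    congr 1
    ext i
    have := blockIndex_le_iff hb (n := n) (m := i)
    simp only [Finset.mem_filter, Finset.mem_range, lt_min_iff]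
    refine and_congr_right fun _ => ?_
    rw [← not_lt, ← this, not_le]
  calc _ = ∑ j ∈ Finset.range k, tsirelson F (cutPart ((Finset.range k).image b) j u) := by
        refine Finset.sum_congr rfl fun j hj => ?_
        rw [Finset.mem_range] at hj
        rw [cutPart]
        congr 2
        ext n
        simp only [Set.mem_ofPred_eq, hcut]
        omega
    _ ≤ ∑ j ∈ Finset.range (k + 1), tsirelson F (cutPart ((Finset.range k).image b) j u) :=
        Finset.sum_le_sum_of_subset (Finset.range_mono (Nat.le_succ k))
    _ ≤ _ := by
        have := sum_cutPart_le (hF k) u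
        rwa [hcard] at this

lemma tsirelson_le_blockNorm (hb : StrictMono b) (u : ℕ → ℝ≥0∞) (m : ℕ) :
    tsirelson F ((Set.Iio m).indicator u) ≤ blockNorm F b u := by
  have hsum : (Set.Iio m).indicator u = ∑ j ∈ Finset.range (m + 1),
      {n | blockIndex b n = j}.indicator ((Set.Iio m).indicator u) := by
    ext n
    rw [Finset.sum_apply]
    by_cases hn : n < m
    · rw [Finset.sum_eq_single (blockIndex b n)]
      · simp
      · intro j _ hj
        exact Set.indicator_of_notMem (fun h => hj (by simpa using h.symm)) _
      · intro h
        have : blockIndex b n ≤ m := (blockIndex_le_iff hb).2 (hn.trans_le hb.le_apply)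
        exact absurd (Finset.mem_range.2 (by omega)) h
    · have h0 : (Set.Iio m).indicator u n = 0 := Set.indicator_of_notMem (by simpa using hn) _
      rw [h0]
      exact (Finset.sum_eq_zero fun j _ => by simp [Set.indicator_apply, hn]).symm
  rw [hsum]
  calc _ ≤ ∑ j ∈ Finset.range (m + 1), tsirelson F
        ({n | blockIndex b n = j}.indicator ((Set.Iio m).indicator u)) :=
        tsirelson_sum_le _ _ tsirelson_zero
    _ ≤ ∑ j ∈ Finset.range (m + 1), tsirelson F ({n | blockIndex b n = j}.indicator u) :=
        Finset.sum_le_sum fun j _ => tsirelson_mono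
          (Set.indicator_mono (Set.indicator_le_self' fun _ _ => zero_le))
    _ ≤ _ := ENNReal.sum_le_tsum _

lemma blockNorm_smul_le (c : ℝ≥0∞) (u : ℕ → ℝ≥0∞) :
    blockNorm F b (c • u) ≤ c * blockNorm F b u := by
  rw [blockNorm, blockNorm, ← ENNReal.tsum_mul_left]
  refine ENNReal.tsum_le_tsum fun j => ?_
  have : {n | blockIndex b n = j}.indicator (c • u) = c • {n | blockIndex b n = j}.indicator u :=
    Set.indicator_const_smul _ c u
  rw [this]
  exact tsirelson_smul_le _ _

lemma le_blockNorm (u : ℕ → ℝ≥0∞) (n : ℕ) : u n ≤ blockNorm F b u := by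
  refine le_trans ?_ (ENNReal.le_tsum (blockIndex b n))
  refine le_trans ?_ (le_tsirelson _ n)
  rw [Set.indicator_of_mem (by simp)]

lemma blockNorm_add_le (hb : StrictMono b) (u : ℕ → ℝ≥0∞) (m : ℕ) :
    blockNorm F b ((Set.Iio (b m)).indicator u) + blockNorm F b ((Set.Ici (b m)).indicator u)
      ≤ blockNorm F b u := by
  rw [blockNorm, blockNorm, blockNorm, ← ENNReal.tsum_add]
  refine ENNReal.tsum_le_tsum fun j => ?_
  simp only [Set.indicator_indicator]
  by_cases hj : j ≤ m
  · have : {n | blockIndex b n = j} ∩ Set.Ici (b m) = ∅ := by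
      ext n
      have := blockIndex_le_iff hb (n := n) (m := m)
      simp only [Set.mem_inter_iff, Set.mem_ofPred_eq, Set.mem_Ici, Set.mem_empty_iff_false,
        iff_false]
      rintro ⟨h1, h2⟩
      omega
    rw [this, Set.indicator_empty]
    refine (add_le_add (tsirelson_mono
      (Set.indicator_le_indicator_of_subset Set.inter_subset_left fun _ => zero_le))
      (tsirelson_zero (F := F)).le).trans_eq (add_zero _)
  · have : {n | blockIndex b n = j} ∩ Set.Iio (b m) = ∅ := by
      ext n
      have := blockIndex_le_iff hb (n := n) (m := m)
      simp only [Set.mem_inter_iff, Set.mem_ofPred_eq, Set.mem_Iio, Set.mem_empty_iff_false,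
        iff_false]
      rintro ⟨h1, h2⟩
      omega
    rw [this, Set.indicator_empty]
    refine (add_le_add (tsirelson_zero (F := F)).le (tsirelson_mono
      (Set.indicator_le_indicator_of_subset Set.inter_subset_left fun _ => zero_le))).trans_eq
      (zero_add _)

end BlockNorm

section Evaluation

variable {F : Set (Finset ℕ)} {r : ℝ} {hr : 0 ≤ r}

lemma isClosed_induction_closedSpan {φ : ℕ → CDelta} {P : CDelta → Prop}
    (hP : IsClosed {z | P z}) (h : ∀ z ∈ Submodule.span ℝ (Set.range φ), P z) {z : CDelta}
    (hz : z ∈ (closedSpan φ).1) : P z :=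
  closure_minimal (show (Submodule.span ℝ (Set.range φ) : Set CDelta) ⊆ {z | P z} from h) hP hz

lemma apply_eq_of_mem_span {z : CDelta}
    (hz : z ∈ Submodule.span ℝ (Set.range (cubeFun F r hr))) :
    ∃ m, ∀ (ω ω₁ : CantorSpace) (c : ℝ), 0 ≤ c → (∀ n < m, weight F ω n = c * weight F ω₁ n) →
      z ω = c ^ r * z ω₁ := by
  induction hz using Submodule.span_induction with
  | mem z hz =>
    obtain ⟨m, rfl⟩ := hz
    exact ⟨m + 1, fun ω ω₁ c hc h => by
      rw [cubeFun_apply, cubeFun_apply, h m (by omega), Real.mul_rpow hc (weight_nonneg _ _)]⟩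
  | zero => exact ⟨0, by simp⟩
  | add z z' _ _ h1 h2 =>
    obtain ⟨m, hm⟩ := h1
    obtain ⟨m', hm'⟩ := h2
    exact ⟨max m m', fun ω ω₁ c hc h => by
      rw [ContinuousMap.add_apply, ContinuousMap.add_apply,
        hm ω ω₁ c hc fun n hn => h n (lt_max_of_lt_left hn),
        hm' ω ω₁ c hc fun n hn => h n (lt_max_of_lt_right hn), mul_add]⟩
  | smul a z _ h1 =>
    obtain ⟨m, hm⟩ := h1
    exact ⟨m, fun ω ω₁ c hc h => by
      rw [ContinuousMap.smul_apply, ContinuousMap.smul_apply, hm ω ω₁ c hc h, smul_eq_mul,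
        smul_eq_mul, mul_left_comm]⟩

lemma apply_eq_of_weight_eq {ω ω₁ : CantorSpace} {c : ℝ} (hc : 0 ≤ c)
    (h : ∀ n, weight F ω n = c * weight F ω₁ n) {z : CDelta}
    (hz : z ∈ (closedSpan (cubeFun F r hr)).1) : z ω = c ^ r * z ω₁ := by
  refine isClosed_induction_closedSpan (P := fun z => z ω = c ^ r * z ω₁)
    (isClosed_eq (by fun_prop) (by fun_prop)) (fun z hz => ?_) hz
  obtain ⟨m, hm⟩ := apply_eq_of_mem_span hz
  exact hm ω ω₁ c hc fun n _ => h n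

/-- A point of the Cantor space with `weight` equal to a unit vector. -/
lemma exists_weight_single (F : Set (Finset ℕ)) (n : ℕ) :
    ∃ ω, ∀ m, weight F ω m = if m = n then 1 else 0 := by
  obtain ⟨ω, hω⟩ := exists_weight_eq (F := F) (Pi.single n 1) fun k => by
    refine (tsirelson_mono (Set.indicator_le_self' fun _ _ => zero_le)).trans
      ((tsirelson_le_tsum _).trans_eq (tsum_pi_single n 1))
  refine ⟨ω, fun m => ?_⟩
  rw [← ENNReal.toReal_ofReal (weight_nonneg (F := F) ω m), hω m, Pi.single_apply]
  split_ifs <;> simp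

/-- A point of the Cantor space encoding the `n`-th unit vector. -/
noncomputable def unitPoint (F : Set (Finset ℕ)) (n : ℕ) : CantorSpace :=
  (exists_weight_single F n).choose

lemma weight_unitPoint (n m : ℕ) : weight F (unitPoint F n) m = if m = n then 1 else 0 :=
  (exists_weight_single F n).choose_spec m

lemma cubeFun_unitPoint (hr' : r ≠ 0) (n m : ℕ) :
    cubeFun F r hr m (unitPoint F n) = if m = n then 1 else 0 := by
  rw [cubeFun_apply, weight_unitPoint]
  split_ifs <;> simp [hr']

lemma apply_eq_add_sum (hr' : r ≠ 0) {ω ω₂ : CantorSpace} {k : ℕ}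
    (h : ∀ n, weight F ω₂ n = if n < k then 0 else weight F ω n) {z : CDelta}
    (hz : z ∈ (closedSpan (cubeFun F r hr)).1) :
    z ω = z ω₂ + ∑ n ∈ Finset.range k, weight F ω n ^ r * z (unitPoint F n) := by
  refine isClosed_induction_closedSpan
    (P := fun z => z ω = z ω₂ + ∑ n ∈ Finset.range k, weight F ω n ^ r * z (unitPoint F n))
    (isClosed_eq (by fun_prop) (by fun_prop)) (fun z hz => ?_) hz
  induction hz using Submodule.span_induction with
  | mem z hz =>
    obtain ⟨m, rfl⟩ := hz
    simp only [cubeFun_unitPoint hr', mul_ite, mul_one, mul_zero, Finset.sum_ite_eq,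
      Finset.mem_range]
    rw [cubeFun_apply, cubeFun_apply, h m]
    split_ifs <;> simp [hr']
  | zero => simp
  | add z z' _ _ h1 h2 =>
    simp only [ContinuousMap.add_apply, mul_add, Finset.sum_add_distrib]
    rw [h1, h2]
    ring
  | smul a z _ h1 =>
    simp only [ContinuousMap.smul_apply, smul_eq_mul, mul_left_comm _ a]
    rw [h1, ← Finset.mul_sum]
    ring

end Evaluation

section BlockSup

variable {F : Set (Finset ℕ)} {b : ℕ → ℕ} {r : ℝ} {hr : 0 ≤ r}

/-- The points of the Cantor space encoding a sequence of block norm at most `1`. -/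
def blockBall (F : Set (Finset ℕ)) (b : ℕ → ℕ) : Set CantorSpace :=
  {ω | blockNorm F b (fun n => ENNReal.ofReal (weight F ω n)) ≤ 1}

/-- The supremum of `|z|` over `blockBall F b`. -/
noncomputable def blockSup (F : Set (Finset ℕ)) (b : ℕ → ℕ) (z : CDelta) : ℝ :=
  ⨆ ω : blockBall F b, |z ω|

lemma exists_mem_blockBall (hb : StrictMono b) {u : ℕ → ℝ≥0∞} (hu : blockNorm F b u ≤ 1) :
    ∃ ω ∈ blockBall F b, ∀ n, ENNReal.ofReal (weight F ω n) = u n := by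
  obtain ⟨ω, hω⟩ := exists_weight_eq (F := F) u fun n => (tsirelson_le_blockNorm hb u n).trans hu
  refine ⟨ω, ?_, hω⟩
  rwa [blockBall, Set.mem_ofPred_eq, funext hω]

lemma blockBall_nonempty (hb : StrictMono b) : (blockBall F b).Nonempty := by
  obtain ⟨ω, hω, _⟩ := exists_mem_blockBall (F := F) hb (u := (0 : ℝ≥0∞) • 0)
    ((blockNorm_smul_le _ _).trans (by simp))
  exact ⟨ω, hω⟩

lemma abs_le_blockSup (z : CDelta) {ω : CantorSpace} (hω : ω ∈ blockBall F b) :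
    |z ω| ≤ blockSup F b z :=
  le_ciSup (f := fun ω : blockBall F b => |z ω|)
    ⟨‖z‖, by rintro _ ⟨ω, rfl⟩; exact z.norm_coe_le_norm ω⟩ ⟨ω, hω⟩

lemma blockSup_le (hb : StrictMono b) {z : CDelta} {c : ℝ} (h : ∀ ω ∈ blockBall F b, |z ω| ≤ c) :
    blockSup F b z ≤ c :=
  haveI : Nonempty (blockBall F b) := (blockBall_nonempty hb).to_subtype
  ciSup_le fun ω => h ω ω.2

lemma blockSup_nonneg (z : CDelta) : 0 ≤ blockSup F b z :=
  Real.iSup_nonneg fun _ => abs_nonneg _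

lemma blockSup_le_norm (hb : StrictMono b) (z : CDelta) : blockSup F b z ≤ ‖z‖ :=
  blockSup_le hb fun ω _ => z.norm_coe_le_norm ω

lemma blockSup_add_le (hb : StrictMono b) (z z' : CDelta) :
    blockSup F b (z + z') ≤ blockSup F b z + blockSup F b z' :=
  blockSup_le hb fun _ hω => (abs_add_le _ _).trans
    (add_le_add (abs_le_blockSup z hω) (abs_le_blockSup z' hω))

lemma blockSup_smul (a : ℝ) (z : CDelta) : blockSup F b (a • z) = |a| * blockSup F b z := by
  rw [blockSup, blockSup, Real.mul_iSup_of_nonneg (abs_nonneg a)]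
  simp [abs_mul]

lemma continuous_blockSup (hb : StrictMono b) : Continuous (blockSup F b) := by
  refine (LipschitzWith.of_le_add fun z z' => ?_).continuous (f := blockSup F b)
  have h := blockSup_add_le (F := F) hb z' (z - z')
  rw [add_sub_cancel] at h
  rw [dist_eq_norm]
  exact h.trans (by gcongr; exact blockSup_le_norm hb _)

lemma norm_le_blockSup (hb : StrictMono b) (hF : ∀ k, (Finset.range k).image b ∈ F)
    {z : CDelta} (hz : z ∈ (closedSpan (cubeFun F r hr)).1) :
    ‖z‖ ≤ 4 ^ r * blockSup F b z := by
  refine isClosed_induction_closedSpan (P := fun z => ‖z‖ ≤ 4 ^ r * blockSup F b z)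
    (isClosed_le continuous_norm (continuous_const.mul (continuous_blockSup hb)))
    (fun z hz => ?_) hz
  have h4 : (0 : ℝ) ≤ 4 ^ r * blockSup F b z :=
    mul_nonneg (Real.rpow_nonneg (by norm_num) _) (blockSup_nonneg z)
  refine (ContinuousMap.norm_le _ h4).2 fun ω => ?_
  obtain ⟨m, hm⟩ := apply_eq_of_mem_span hz
  set u := (Set.Iio m).indicator fun n => ENNReal.ofReal (weight F ω n)
  have hu : blockNorm F b u ≤ 4 := by
    refine (blockNorm_le hb hF u).trans ?_
    calc 2 * tsirelson F u ≤ 2 * 2 := by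
          gcongr
          exact tsirelson_weight_le m ω
      _ = 4 := by norm_num
  obtain ⟨ω₁, hω₁, hω₁u⟩ := exists_mem_blockBall (F := F) hb (u := (4⁻¹ : ℝ≥0∞) • u) <| by
    refine (blockNorm_smul_le _ _).trans ?_
    calc 4⁻¹ * blockNorm F b u ≤ 4⁻¹ * 4 := by gcongr
      _ = 1 := ENNReal.inv_mul_cancel (by simp) (by simp)
  have hweight : ∀ n < m, weight F ω n = 4 * weight F ω₁ n := by
    intro n hn
    have h1 := congrArg ENNReal.toReal (hω₁u n)
    rw [ENNReal.toReal_ofReal (weight_nonneg _ _), Pi.smul_apply,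
      show u n = ENNReal.ofReal (weight F ω n) from Set.indicator_of_mem (Set.mem_Iio.2 hn) _,
      smul_eq_mul, ENNReal.toReal_mul,
      ENNReal.toReal_ofReal (weight_nonneg _ _)] at h1
    rw [h1]
    simp
  have key : z ω = 4 ^ r * z ω₁ := hm ω ω₁ 4 (by norm_num) hweight
  rw [Real.norm_eq_abs, key, abs_mul, abs_of_nonneg (Real.rpow_nonneg (by norm_num) _)]
  gcongr
  exact abs_le_blockSup z hω₁

lemma abs_le_rpow_mul_blockSup (hb : StrictMono b) {ω : CantorSpace} {s : ℝ≥0∞}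
    (hs : blockNorm F b (fun n => ENNReal.ofReal (weight F ω n)) ≤ s) (hs1 : s ≤ 1) {z : CDelta}
    (hz : z ∈ (closedSpan (cubeFun F r hr)).1) :
    |z ω| ≤ s.toReal ^ r * blockSup F b z := by
  have hs_top : s ≠ ⊤ := ne_top_of_le_ne_top ENNReal.one_ne_top hs1
  obtain ⟨ω₁, hω₁, hω₁u⟩ := exists_mem_blockBall (F := F) hb
      (u := s⁻¹ • fun n => ENNReal.ofReal (weight F ω n)) <| by
    refine (blockNorm_smul_le _ _).trans ((mul_le_mul_right hs _).trans ?_)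
    exact ENNReal.inv_mul_le_one s
  have hweight : ∀ n, weight F ω n = s.toReal * weight F ω₁ n := by
    intro n
    have h1 : ENNReal.ofReal (weight F ω n) ≤ s := (le_blockNorm _ n).trans hs
    rw [← ENNReal.toReal_ofReal (weight_nonneg (F := F) ω₁ n), hω₁u n, ← ENNReal.toReal_mul,
      Pi.smul_apply, smul_eq_mul]
    rcases eq_or_ne s 0 with rfl | h0
    · rw [zero_mul, ENNReal.toReal_zero, ← ENNReal.toReal_ofReal (weight_nonneg (F := F) ω n),
        le_antisymm h1 zero_le, ENNReal.toReal_zero]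
    · rw [← mul_assoc, ENNReal.mul_inv_cancel h0 hs_top, one_mul,
        ENNReal.toReal_ofReal (weight_nonneg _ _)]
  rw [apply_eq_of_weight_eq ENNReal.toReal_nonneg hweight hz, abs_mul,
    abs_of_nonneg (Real.rpow_nonneg ENNReal.toReal_nonneg _)]
  gcongr
  exact abs_le_blockSup z hω₁

/-- The upper `p`-estimate for `blockSup`, where `r = 1 - 1 / p`. -/
lemma blockSup_add_smul_le (hb : StrictMono b) {p : ℝ} (hp : 1 < p) (hrp : r = 1 - p⁻¹)
    {y : CDelta} (hy : y ∈ Submodule.span ℝ (Set.range (cubeFun F r hr))) {ε : ℝ} (hε : 0 ≤ ε)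
    (hyε : blockSup F b y ≤ 1 + ε) :
    ∃ k, ∀ x ∈ (closedSpan (cubeFun F r hr)).1, (∀ n < k, x (unitPoint F n) = 0) →
      blockSup F b x ≤ 1 → ∀ τ : ℝ, 0 ≤ τ → blockSup F b (y + τ • x) ≤ 1 + ε + p⁻¹ * τ ^ p := by
  have hp0 : 0 < p⁻¹ := by positivity
  have hr0 : r ≠ 0 := by
    have := inv_lt_one_of_one_lt₀ hp
    rw [hrp]
    exact (sub_pos.2 this).ne'
  obtain ⟨m, hm⟩ := apply_eq_of_mem_span hy
  have hymem : y ∈ (closedSpan (cubeFun F r hr)).1 := Submodule.le_topologicalClosure _ hy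
  refine ⟨b m, fun x hx hx0 hx1 τ hτ => blockSup_le hb fun ω hω => ?_⟩
  set u : ℕ → ℝ≥0∞ := fun n => ENNReal.ofReal (weight F ω n)
  set s := blockNorm F b ((Set.Iio (b m)).indicator u)
  set t := blockNorm F b ((Set.Ici (b m)).indicator u)
  have hst : s + t ≤ 1 := (blockNorm_add_le hb u m).trans hω
  have hs1 : s ≤ 1 := le_self_add.trans hst
  have ht1 : t ≤ 1 := le_add_self.trans hst
  obtain ⟨ω₁, -, hω₁u⟩ := exists_mem_blockBall (F := F) hb hs1
  obtain ⟨ω₂, -, hω₂u⟩ := exists_mem_blockBall (F := F) hb ht1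
  have hyω : |y ω| ≤ s.toReal ^ r * blockSup F b y := by
    rw [hm ω ω₁ 1 zero_le_one fun n hn => ?_, Real.one_rpow, one_mul]
    · exact abs_le_rpow_mul_blockSup hb (by rw [funext hω₁u]) hs1 hymem
    · rw [one_mul, ← ENNReal.toReal_ofReal (weight_nonneg (F := F) ω₁ n), hω₁u n,
        Set.indicator_of_mem (Set.mem_Iio.2 (hn.trans_le hb.le_apply)),
        ENNReal.toReal_ofReal (weight_nonneg _ _)]
  have hxω : |x ω| ≤ t.toReal ^ r * blockSup F b x := by
    rw [apply_eq_add_sum hr0 (ω₂ := ω₂) (k := b m) (fun n => ?_) hx,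
      Finset.sum_eq_zero fun n hn => by rw [hx0 n (Finset.mem_range.1 hn), mul_zero], add_zero]
    · exact abs_le_rpow_mul_blockSup hb (by rw [funext hω₂u]) ht1 hx
    · rw [← ENNReal.toReal_ofReal (weight_nonneg (F := F) ω₂ n), hω₂u n, Set.indicator_apply]
      simp only [Set.mem_Ici]
      split_ifs with h1 h2 h2
      · omega
      · exact ENNReal.toReal_ofReal (weight_nonneg _ _)
      · rfl
      · omega
  have hstR : s.toReal + t.toReal ≤ 1 := by
    rw [← ENNReal.toReal_add (ne_top_of_le_ne_top ENNReal.one_ne_top hs1)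
      (ne_top_of_le_ne_top ENNReal.one_ne_top ht1)]
    exact ENNReal.toReal_mono ENNReal.one_ne_top hst
  have hs0 : 0 ≤ s.toReal := ENNReal.toReal_nonneg
  have ht0 : 0 ≤ t.toReal := ENNReal.toReal_nonneg
  have hyoung1 := Real.geom_mean_le_arith_mean2_weighted hr hp0.le hs0 zero_le_one
    (by rw [hrp]; ring)
  have hyoung2 := Real.geom_mean_le_arith_mean2_weighted hr hp0.le ht0 (Real.rpow_nonneg hτ p)
    (by rw [hrp]; ring)
  rw [Real.one_rpow, mul_one, mul_one] at hyoung1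
  rw [Real.rpow_rpow_inv hτ (by positivity)] at hyoung2
  have hsr1 : s.toReal ^ r ≤ 1 := Real.rpow_le_one hs0 (by linarith) hr
  calc |(y + τ • x) ω| ≤ |y ω| + |τ * x ω| := abs_add_le _ _
    _ = |y ω| + τ * |x ω| := by rw [abs_mul, abs_of_nonneg hτ]
    _ ≤ s.toReal ^ r * (1 + ε) + τ * (t.toReal ^ r * 1) := by
        have hsr := Real.rpow_nonneg hs0 r
        have htr := Real.rpow_nonneg ht0 r
        gcongr
        · exact hyω.trans (by gcongr)
        · exact hxω.trans (by gcongr)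
    _ ≤ 1 + ε + p⁻¹ * τ ^ p := by
        have h1 : s.toReal ^ r * ε ≤ ε := mul_le_of_le_one_left hε hsr1
        have h2 : r * (s.toReal + t.toReal) ≤ r := mul_le_of_le_one_right hr hstR
        nlinarith

end BlockSup

lemma rhoN_le {X : Type*} [NormedAddCommGroup X] [NormedSpace ℝ X] {N : X → ℝ}
    (hN : IsNormFn X N) {τ c : ℝ} (hτ : 0 ≤ τ) (hc : 0 ≤ c)
    (h : ∀ y, N y ≤ 1 → ∀ ε > 0, ∃ E : Submodule ℝ X, IsClosed (E : Set X) ∧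
      FiniteDimensional ℝ (X ⧸ E) ∧ ∀ x ∈ E, N x ≤ 1 → N (y + τ • x) ≤ 1 + c + ε) :
    rhoN X N τ ≤ c := by
  rw [rhoN]
  split_ifs
  · exact hc
  refine Real.sSup_le ?_ hc
  rintro _ ⟨y, hy, rfl⟩
  refine le_of_forall_pos_le_add fun ε hε => ?_
  obtain ⟨E, hE1, hE2, hE⟩ := h y hy ε hε
  refine csInf_le_of_le ⟨-1, ?_⟩ ⟨E, hE1, hE2, rfl⟩ ?_
  · rintro _ ⟨E, -, -, rfl⟩
    refine (show (-1 : ℝ) ≤ N (y + τ • (0 : X)) - 1 by linarith [hN.1 (y + τ • (0 : X))]).trans ?_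
    refine le_csSup ⟨τ, ?_⟩ ⟨0, E.zero_mem, by rw [(hN.2.1 0).2 rfl]; exact zero_le_one, rfl⟩
    rintro _ ⟨x, -, hx, rfl⟩
    have h1 := hN.2.2.2 y (τ • x)
    rw [hN.2.2.1, abs_of_nonneg hτ] at h1
    nlinarith
  · refine Real.sSup_le ?_ (by positivity)
    rintro _ ⟨x, hx, hx1, rfl⟩
    linarith [hE x hx hx1]

lemma exists_finiteCodim {X : Type*} [NormedAddCommGroup X] [NormedSpace ℝ X] (k : ℕ)
    (f : ℕ → X →L[ℝ] ℝ) : ∃ E : Submodule ℝ X, IsClosed (E : Set X) ∧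
      FiniteDimensional ℝ (X ⧸ E) ∧ ∀ x, x ∈ E ↔ ∀ n < k, f n x = 0 := by
  let L : X →L[ℝ] (Fin k → ℝ) := ContinuousLinearMap.pi fun i => f i
  refine ⟨LinearMap.ker L.toLinearMap, L.isClosed_ker,
    Module.Finite.equiv L.toLinearMap.quotKerEquivRange.symm, fun x => ?_⟩
  rw [LinearMap.mem_ker]
  constructor
  · intro h n hn
    exact congrFun h ⟨n, hn⟩
  · intro h
    ext i
    exact h i i.2

lemma pAUSable_closedSpan {F : Set (Finset ℕ)} {b : ℕ → ℕ} (hb : StrictMono b)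
    (hF : ∀ k, (Finset.range k).image b ∈ F) {p r : ℝ} (hp : 1 < p) (hrp : r = 1 - p⁻¹)
    (hr : 0 ≤ r) : PAUSable p (closedSpan (cubeFun F r hr)).1 := by
  have h4 : (0 : ℝ) < 4 ^ r := Real.rpow_pos_of_pos (by norm_num) _
  have hnorm : IsNormFn (closedSpan (cubeFun F r hr)).1 fun z => blockSup F b z := by
    refine ⟨fun z => blockSup_nonneg _, fun z => ⟨fun h => ?_, ?_⟩, fun a z => blockSup_smul _ _,
      fun z z' => blockSup_add_le hb _ _⟩
    · have := norm_le_blockSup hb hF z.2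
      rw [show blockSup F b z = 0 from h, mul_zero] at this
      exact norm_le_zero_iff.1 this
    · rintro rfl
      exact le_antisymm ((blockSup_le_norm hb _).trans (by simp)) (blockSup_nonneg _)
  refine ⟨fun z => blockSup F b z, ⟨hnorm, (4 ^ r)⁻¹, by positivity, 1, one_pos, fun z => ⟨?_, ?_⟩⟩,
    p⁻¹, by positivity, fun τ hτ => ?_⟩
  · rw [inv_mul_le_iff₀ h4]
    exact norm_le_blockSup hb hF z.2
  · rw [one_mul]
    exact blockSup_le_norm hb _
  · refine rhoN_le hnorm hτ (by positivity) fun y hy ε hε => ?_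
    obtain ⟨y', hy', hyy'⟩ := Metric.mem_closure_iff.1
      (show (y : CDelta) ∈ closure (Submodule.span ℝ (Set.range (cubeFun F r hr)) : Set CDelta)
        from y.2) (ε / 2) (by positivity)
    rw [dist_eq_norm] at hyy'
    have hsub : ∀ v w : CDelta, blockSup F b v ≤ blockSup F b w + ‖v - w‖ := fun v w => by
      have h := blockSup_add_le (F := F) hb w (v - w)
      rw [add_sub_cancel] at h
      linarith [blockSup_le_norm (F := F) hb (v - w)]
    have hy'1 : blockSup F b y' ≤ 1 + ε / 2 := by
      have := hsub y' y
      rw [norm_sub_rev] at this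
      linarith
    obtain ⟨k, hk⟩ := blockSup_add_smul_le hb hp hrp hy' (by positivity) hy'1
    obtain ⟨E, hE1, hE2, hE⟩ := exists_finiteCodim (X := (closedSpan (cubeFun F r hr)).1) k fun n =>
      (ContinuousMap.evalCLM ℝ (unitPoint F n)).comp
        (closedSpan (cubeFun F r hr)).1.subtypeL
    refine ⟨E, hE1, hE2, fun x hx hx1 => ?_⟩
    have h1 := hk x x.2 (fun n hn => (hE x).1 hx n hn) hx1 τ hτ
    have h2 := hsub (y + τ • x : CDelta) (y' + τ • x)
    rw [add_sub_add_right_eq_sub] at h2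
    have h3 : ((y + τ • x : (closedSpan (cubeFun F r hr)).1) : CDelta) = y + τ • (x : CDelta) := rfl
    simp only [h3]
    linarith

section AsymptoticSmoothness

variable {X : Type*} [NormedAddCommGroup X] [NormedSpace ℝ X] {N : X → ℝ}

lemma exists_finiteCodim_of_rhoN_le (hX : ¬ FiniteDimensional ℝ X) (hN : IsNormFn X N)
    {τ c : ℝ} (hτ : 0 ≤ τ) (h : rhoN X N τ ≤ c) {y : X} (hy : N y ≤ 1) {ε : ℝ} (hε : 0 < ε) :
    ∃ E : Submodule ℝ X, IsClosed (E : Set X) ∧ FiniteDimensional ℝ (X ⧸ E) ∧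
      ∀ x ∈ E, N x ≤ 1 → N (y + τ • x) ≤ 1 + c + ε := by
  have hbound : ∀ y x, N y ≤ 1 → N x ≤ 1 → N (y + τ • x) - 1 ≤ τ := by
    intro y x hy hx
    have h1 := hN.2.2.2 y (τ • x)
    rw [hN.2.2.1, abs_of_nonneg hτ] at h1
    nlinarith
  have hbdd : ∀ y, N y ≤ 1 → ∀ E : Submodule ℝ X,
      BddAbove {t : ℝ | ∃ x ∈ E, N x ≤ 1 ∧ t = N (y + τ • x) - 1} := by
    rintro y hy E
    refine ⟨τ, ?_⟩
    rintro _ ⟨x, -, hx, rfl⟩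
    exact hbound y x hy hx
  let U : X → Set ℝ := fun y => {s : ℝ | ∃ E : Submodule ℝ X,
    IsClosed (E : Set X) ∧ FiniteDimensional ℝ (X ⧸ E) ∧
      s = sSup {t : ℝ | ∃ x ∈ E, N x ≤ 1 ∧ t = N (y + τ • x) - 1}}
  have hbelow : ∀ y, N y ≤ 1 → BddBelow (U y) := by
    refine fun y hy => ⟨-1, ?_⟩
    rintro _ ⟨E, -, -, rfl⟩
    refine (show (-1 : ℝ) ≤ N (y + τ • (0 : X)) - 1 by linarith [hN.1 (y + τ • (0 : X))]).trans ?_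
    exact le_csSup (hbdd y hy E)
      ⟨0, E.zero_mem, by rw [(hN.2.1 0).2 rfl]; exact zero_le_one, rfl⟩
  have htop : ∀ y,
      sSup {t : ℝ | ∃ x ∈ (⊤ : Submodule ℝ X), N x ≤ 1 ∧ t = N (y + τ • x) - 1} ∈ U y :=
    fun y => ⟨⊤, isClosed_univ, inferInstance, rfl⟩
  have hinf : ∀ y, N y ≤ 1 → sInf (U y) ≤ τ := by
    intro y hy
    refine (csInf_le (hbelow y hy) (htop y)).trans (Real.sSup_le ?_ hτ)
    rintro _ ⟨x, -, hx, rfl⟩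
    exact hbound y x hy hx
  rw [rhoN, if_neg hX] at h
  have hlt : sInf (U y) < c + ε := by
    have hmem : sInf (U y) ∈ {r : ℝ | ∃ y : X, N y ≤ 1 ∧ r = sInf (U y)} := ⟨y, hy, rfl⟩
    have hU : BddAbove {r : ℝ | ∃ y : X, N y ≤ 1 ∧ r = sInf (U y)} := by
      refine ⟨τ, ?_⟩
      rintro _ ⟨y, hy, rfl⟩
      exact hinf y hy
    exact lt_of_le_of_lt ((le_csSup hU hmem).trans h) (by linarith)
  obtain ⟨_, ⟨E, hE1, hE2, rfl⟩, hE⟩ := exists_lt_of_csInf_lt ⟨_, htop y⟩ hlt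
  refine ⟨E, hE1, hE2, fun x hx hx1 => ?_⟩
  have := le_csSup (hbdd y hy E) ⟨x, hx, hx1, rfl⟩
  linarith

lemma exists_infinite_subset_near (E : Submodule ℝ X) (hE : IsClosed (E : Set X))
    (hE' : FiniteDimensional ℝ (X ⧸ E)) {f : ℕ → X} {R : ℝ} (hf : ∀ n, ‖f n‖ ≤ R) {η : ℝ}
    (hη : 0 < η) {M : Set ℕ} (hM : M.Infinite) :
    ∃ M' ⊆ M, M'.Infinite ∧ ∀ i ∈ M', ∀ j ∈ M', ∃ e ∈ E, ‖f i - f j - e‖ < η := by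
  have : ProperSpace (X ⧸ E) := FiniteDimensional.proper ℝ _
  obtain ⟨t, ht, htcover⟩ := Metric.totallyBounded_iff.1
    (isCompact_closedBall (0 : X ⧸ E) R).totallyBounded (η / 2) (by positivity)
  obtain ⟨y, -, hy⟩ : ∃ y ∈ t, {n ∈ M | dist (E.mkQ (f n)) y < η / 2}.Infinite := by
    by_contra! hcon
    refine hM ((ht.biUnion fun y hy => hcon y hy).subset fun n hn => ?_)
    have : E.mkQ (f n) ∈ closedBall (0 : X ⧸ E) R := by
      rw [mem_closedBall_zero_iff]
      exact (Submodule.Quotient.norm_mk_le E (f n)).trans (hf n)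
    obtain ⟨y, hy, hny⟩ := Set.mem_iUnion₂.1 (htcover this)
    exact Set.mem_iUnion₂.2 ⟨y, hy, hn, hny⟩
  refine ⟨_, Set.sep_subset _ _, hy, fun i hi j hj => ?_⟩
  have hd : ‖E.mkQ (f i - f j)‖ < η := by
    rw [map_sub, ← dist_eq_norm]
    calc _ ≤ dist (E.mkQ (f i)) y + dist (E.mkQ (f j)) y := dist_triangle_right _ _ _
      _ < η / 2 + η / 2 := add_lt_add hi.2 hj.2
      _ = η := by ring
  obtain ⟨x, hx, hxη⟩ := Submodule.Quotient.norm_mk_lt (E.mkQ (f i - f j)) (sub_pos.2 hd)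
  refine ⟨f i - f j - x, ?_, ?_⟩
  · rw [← Submodule.ker_mkQ E, LinearMap.mem_ker, map_sub, sub_eq_zero]
    exact hx.symm
  · rw [sub_sub_cancel]
    linarith

lemma exists_finiteCodim_of_rhoN_le_rpow (hX : ¬ FiniteDimensional ℝ X) (hN : IsNormFn X N)
    {C p : ℝ} (hρ : ∀ τ, 0 ≤ τ → rhoN X N τ ≤ C * τ ^ p) (y : X) {t : ℝ} (ht : 0 ≤ t) {ε : ℝ}
    (hε : 0 < ε) : ∃ E : Submodule ℝ X, IsClosed (E : Set X) ∧ FiniteDimensional ℝ (X ⧸ E) ∧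
      ∀ x ∈ E, N x ≤ 1 → N (y + t • x) ≤ max 1 (N y) * (1 + C * t ^ p + ε) := by
  set l := max 1 (N y)
  have hl : 1 ≤ l := le_max_left _ _
  have hl0 : 0 < l := by linarith
  have hlinv : |l⁻¹| = l⁻¹ := abs_of_pos (inv_pos.2 hl0)
  obtain ⟨E, hE1, hE2, hE⟩ := exists_finiteCodim_of_rhoN_le hX hN ht (hρ t ht) (y := l⁻¹ • y)
    (by rw [hN.2.2.1, hlinv, inv_mul_le_iff₀ hl0, mul_one]; exact le_max_right _ _) hε
  refine ⟨E, hE1, hE2, fun x hx hx1 => ?_⟩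
  have h1 := hE (l⁻¹ • x) (E.smul_mem _ hx) <| by
    rw [hN.2.2.1, hlinv, inv_mul_le_iff₀ hl0, mul_one]
    exact hx1.trans hl
  rw [smul_comm, ← smul_add, hN.2.2.1, hlinv, inv_mul_le_iff₀ hl0] at h1
  exact h1

lemma exists_infinite_subset_step (hX : ¬ FiniteDimensional ℝ X) (hN : IsEquivNorm X N)
    {C p : ℝ} (hρ : ∀ τ, 0 ≤ τ → rhoN X N τ ≤ C * τ ^ p) {f : ℕ → X} (hf : ∀ n, N (f n) ≤ 1 / 4)
    {ε : ℝ} (hε : 0 < ε) (y : X) {t : ℝ} (ht : 0 ≤ t) (ht1 : t ≤ 1) {M : Set ℕ}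
    (hM : M.Infinite) : ∃ M' ⊆ M, M'.Infinite ∧ ∀ i ∈ M', ∀ j ∈ M',
      N (y + t • (f i - f j)) ≤ max 1 (N y) * (1 + C * t ^ p + ε) := by
  obtain ⟨hN, a, ha, b, hb, hab⟩ := hN
  obtain ⟨E, hE1, hE2, hE⟩ := exists_finiteCodim_of_rhoN_le_rpow hX hN hρ y ht (half_pos hε)
  have hfR : ∀ n, ‖f n‖ ≤ 1 / 4 / a := fun n => by
    rw [le_div_iff₀' ha]
    exact ((hab _).1).trans (hf n)
  obtain ⟨M', hM'M, hM', hnear⟩ := exists_infinite_subset_near E hE1 hE2 hfR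
    (η := min (1 / 2) (ε / 2) / b) (by positivity) hM
  refine ⟨M', hM'M, hM', fun i hi j hj => ?_⟩
  obtain ⟨e, he, hd⟩ := hnear i hi j hj
  set d := f i - f j - e with hdef
  have hNd : N d ≤ min (1 / 2) (ε / 2) := by
    rw [lt_div_iff₀' hb] at hd
    exact ((hab d).2).trans hd.le
  have hneg : ∀ x, N (-x) = N x := fun x => by
    have := hN.2.2.1 (-1) x
    simpa using this
  have hNe : N e ≤ 1 := by
    have h1 : e = f i + (-f j + -d) := by rw [hdef]; abel
    have h2 := hN.2.2.2 (f i) (-f j + -d)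
    have h3 := hN.2.2.2 (-f j) (-d)
    rw [hneg, hneg] at h3
    rw [h1]
    linarith [hf i, hf j, hNd.trans (min_le_left _ _)]
  have h1 : y + t • (f i - f j) = (y + t • e) + t • d := by
    rw [add_assoc, ← smul_add, hdef, add_sub_cancel]
  have h2 := hN.2.2.2 (y + t • e) (t • d)
  rw [hN.2.2.1, abs_of_nonneg ht] at h2
  have h3 : t * N d ≤ ε / 2 := by
    nlinarith [hN.1 d, hNd.trans (min_le_right _ _)]
  rw [h1]
  have h4 := hE e he hNe
  have h5 : (1 : ℝ) ≤ max 1 (N y) := le_max_left _ _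
  nlinarith

lemma exists_infinite_subset_steps (hX : ¬ FiniteDimensional ℝ X) (hN : IsEquivNorm X N)
    {C p : ℝ} (hρ : ∀ τ, 0 ≤ τ → rhoN X N τ ≤ C * τ ^ p) {f : ℕ → X} (hf : ∀ n, N (f n) ≤ 1 / 4)
    {ε : ℝ} (hε : 0 < ε) (S : Finset (X × ℝ)) (hS : ∀ s ∈ S, 0 ≤ s.2 ∧ s.2 ≤ 1) {M : Set ℕ}
    (hM : M.Infinite) : ∃ M' ⊆ M, M'.Infinite ∧ ∀ s ∈ S, ∀ i ∈ M', ∀ j ∈ M',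
      N (s.1 + s.2 • (f i - f j)) ≤ max 1 (N s.1) * (1 + C * s.2 ^ p + ε) := by
  classical
  induction S using Finset.induction_on with
  | empty => exact ⟨M, subset_rfl, hM, by simp⟩
  | insert s S _ ih =>
    obtain ⟨M₁, hM₁M, hM₁, h₁⟩ := ih fun s' hs' => hS s' (Finset.mem_insert_of_mem hs')
    obtain ⟨hs0, hs1⟩ := hS s (Finset.mem_insert_self _ _)
    obtain ⟨M₂, hM₂M, hM₂, h₂⟩ := exists_infinite_subset_step hX hN hρ hf hε s.1 hs0 hs1 hM₁
    refine ⟨M₂, hM₂M.trans hM₁M, hM₂, fun s' hs' i hi j hj => ?_⟩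
    rcases Finset.mem_insert.1 hs' with rfl | hs'
    · exact h₂ i hi j hj
    · exact h₁ s' hs' i (hM₂M hi) j (hM₂M hj)

/-- Interlaced indices along which the differences `f (i k) - f (j k)` satisfy an upper
`p`-estimate for all coefficients taken from the finite sets `Q k`. -/
lemma exists_upper_estimate (hX : ¬ FiniteDimensional ℝ X) (hN : IsEquivNorm X N)
    {C p : ℝ} (hC : 0 ≤ C) (hρ : ∀ τ, 0 ≤ τ → rhoN X N τ ≤ C * τ ^ p) {f : ℕ → X}
    (hf : ∀ n, N (f n) ≤ 1 / 4) (Q : ℕ → Finset ℝ) (hQ : ∀ k, ∀ t ∈ Q k, 0 ≤ t ∧ t ≤ 1) :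
    ∃ i j : ℕ → ℕ, (∀ k, i k < j k) ∧ (∀ k, j k < i (k + 1)) ∧
      ∀ a : ℕ → ℝ, (∀ k, a k ∈ Q k) → ∀ n,
        N (∑ k ∈ Finset.range n, a k • (f (i k) - f (j k))) ≤
          Real.exp (C * ∑ k ∈ Finset.range n, a k ^ p + 1) := by
  classical
  have step : ∀ (Y : Finset X) (m k : ℕ), ∃ i j, m < i ∧ i < j ∧ ∀ y ∈ Y, ∀ t ∈ Q k,
      N (y + t • (f i - f j)) ≤ max 1 (N y) * (1 + C * t ^ p + (1 / 2) ^ (k + 1)) := by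
    intro Y m k
    obtain ⟨M, hMm, hM, h⟩ := exists_infinite_subset_steps hX hN hρ hf
      (ε := (1 / 2) ^ (k + 1)) (by positivity) (Y ×ˢ Q k)
      (fun s hs => hQ k s.2 (Finset.mem_product.1 hs).2) (Set.Ioi_infinite m)
    obtain ⟨i, hi⟩ := hM.nonempty
    obtain ⟨j, hj, hij⟩ := hM.exists_gt i
    exact ⟨i, j, hMm hi, hij, fun y hy t ht =>
      h (y, t) (Finset.mem_product.2 ⟨hy, ht⟩) i hi j hj⟩
  choose I J hI hJ hIJ using step
  let st : ℕ → Finset X × ℕ := fun n => Nat.rec (motive := fun _ => Finset X × ℕ) ({0}, 0)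
    (fun k s => ((s.1 ×ˢ Q k).image fun q => q.1 + q.2 • (f (I s.1 s.2 k) - f (J s.1 s.2 k)),
      J s.1 s.2 k)) n
  let i : ℕ → ℕ := fun k => I (st k).1 (st k).2 k
  let j : ℕ → ℕ := fun k => J (st k).1 (st k).2 k
  refine ⟨i, j, fun k => hJ _ _ _, fun k => hI _ _ _, fun a ha n => ?_⟩
  have hmem : ∀ n, ∑ k ∈ Finset.range n, a k • (f (i k) - f (j k)) ∈ (st n).1 := by
    intro n
    induction n with
    | zero => exact Finset.mem_singleton_self 0
    | succ n ih =>
      rw [Finset.sum_range_succ]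
      exact Finset.mem_image.2 ⟨(_, a n), Finset.mem_product.2 ⟨ih, ha n⟩, rfl⟩
  have hmax : ∀ n, max 1 (N (∑ k ∈ Finset.range n, a k • (f (i k) - f (j k)))) ≤
      Real.exp (∑ k ∈ Finset.range n, (C * a k ^ p + (1 / 2) ^ (k + 1))) := by
    intro n
    induction n with
    | zero => simp [(hN.1.2.1 0).2 rfl]
    | succ n ih =>
      rw [Finset.sum_range_succ, Finset.sum_range_succ, Real.exp_add]
      have hpow : 0 ≤ a n ^ p := Real.rpow_nonneg (hQ n _ (ha n)).1 p
      have hfac : 1 ≤ 1 + C * a n ^ p + (1 / 2) ^ (n + 1) := by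
        have : (0 : ℝ) ≤ (1 / 2) ^ (n + 1) := by positivity
        have := mul_nonneg hC hpow
        linarith
      have hexp : 1 + C * a n ^ p + (1 / 2) ^ (n + 1) ≤
          Real.exp (C * a n ^ p + (1 / 2) ^ (n + 1)) := by
        have := Real.add_one_le_exp (C * a n ^ p + (1 / 2) ^ (n + 1))
        linarith
      have h1 := hIJ (st n).1 (st n).2 n _ (hmem n) _ (ha n)
      have h2 : (1 : ℝ) ≤ max 1 (N (∑ k ∈ Finset.range n, a k • (f (i k) - f (j k)))) :=
        le_max_left _ _
      calc _ ≤ max 1 (N (∑ k ∈ Finset.range n, a k • (f (i k) - f (j k)))) *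
            (1 + C * a n ^ p + (1 / 2) ^ (n + 1)) :=
            max_le (one_le_mul_of_one_le_of_one_le h2 hfac) h1
        _ ≤ _ := by gcongr
  refine ((le_max_right _ _).trans (hmax n)).trans (Real.exp_le_exp.2 ?_)
  rw [Finset.sum_add_distrib, ← Finset.mul_sum]
  gcongr
  have h1 : ∑ k ∈ Finset.range n, (1 / 2 : ℝ) ^ (k + 1) = 1 - (1 / 2) ^ n := by
    induction n with
    | zero => simp
    | succ n ih =>
      rw [Finset.sum_range_succ, ih, pow_succ]
      ring
  rw [h1]
  have : (0 : ℝ) ≤ (1 / 2) ^ n := by positivity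
  linarith

end AsymptoticSmoothness

section NotSmooth

variable {F : Set (Finset ℕ)} {r : ℝ} {hr : 0 ≤ r}

lemma cubeFun_mem_closedSpan (n : ℕ) :
    cubeFun F r hr n ∈ (closedSpan (cubeFun F r hr)).1 :=
  Submodule.le_topologicalClosure _ (Submodule.subset_span ⟨n, rfl⟩)

lemma norm_cubeFun_le (n : ℕ) : ‖cubeFun F r hr n‖ ≤ 1 := by
  refine (ContinuousMap.norm_le _ zero_le_one).2 fun ω => ?_
  rw [cubeFun_apply, Real.norm_eq_abs, abs_of_nonneg (Real.rpow_nonneg (weight_nonneg _ _) _)]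
  exact Real.rpow_le_one (weight_nonneg _ _)
    ((weight_le _ _).trans (cantorToHilbert ω n).2.2) hr

lemma not_finiteDimensional_closedSpan (hr' : r ≠ 0) :
    ¬ FiniteDimensional ℝ (closedSpan (cubeFun F r hr)).1 := by
  intro h
  have hli : LinearIndependent ℝ fun n =>
      (⟨cubeFun F r hr n, cubeFun_mem_closedSpan n⟩ : (closedSpan (cubeFun F r hr)).1) := by
    refine LinearIndependent.of_comp (closedSpan (cubeFun F r hr)).1.subtype ?_
    rw [linearIndependent_iff']
    intro s g hg i hi
    have h1 : (∑ n ∈ s, g n • cubeFun F r hr n) (unitPoint F i) = 0 := by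
      rw [show ∑ n ∈ s, g n • cubeFun F r hr n = 0 from hg]
      rfl
    simpa [ContinuousMap.sum_apply, cubeFun_unitPoint hr', hi] using h1
  exact not_finite_iff_infinite.2 (inferInstanceAs (Infinite ℕ)) hli.finite

/-- The multiples of `4⁻¹ ^ (k + 1)` in the unit interval. -/
noncomputable def grid (k : ℕ) : Finset ℝ :=
  (Finset.range (4 ^ (k + 1) + 1)).image fun n : ℕ => (n : ℝ) / 4 ^ (k + 1)

lemma mem_grid_bounds {k : ℕ} {t : ℝ} (ht : t ∈ grid k) : 0 ≤ t ∧ t ≤ 1 := by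
  obtain ⟨n, hn, rfl⟩ := Finset.mem_image.1 ht
  refine ⟨by positivity, ?_⟩
  rw [div_le_one (by positivity)]
  exact_mod_cast Nat.lt_succ_iff.1 (Finset.mem_range.1 hn)

lemma exists_mem_grid (k : ℕ) {v : ℝ} (hv : 0 ≤ v) (hv1 : v ≤ 1) :
    ∃ t ∈ grid k, t ≤ v ∧ v ≤ t + (1 / 4) ^ (k + 1) := by
  have h4 : (0 : ℝ) < 4 ^ (k + 1) := by positivity
  refine ⟨_, Finset.mem_image_of_mem _ (a := ⌊v * 4 ^ (k + 1)⌋₊) ?_, ?_, ?_⟩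
  · rw [Finset.mem_range, Nat.lt_succ_iff]
    refine Nat.floor_le_of_le ?_
    push_cast
    exact mul_le_of_le_one_left h4.le hv1
  · rw [div_le_iff₀ h4]
    exact Nat.floor_le (by positivity)
  · rw [one_div, inv_pow, ← one_div, ← add_div, le_div_iff₀ h4]
    exact (Nat.lt_floor_add_one _).le

lemma sum_quarter_pow_le (n : ℕ) : ∑ k ∈ Finset.range n, (1 / 4 : ℝ) ^ (k + 1) ≤ 1 / 3 := by
  have h : ∑ k ∈ Finset.range n, (1 / 4 : ℝ) ^ (k + 1) = 1 / 3 - 1 / 3 * (1 / 4) ^ n := by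
    induction n with
    | zero => simp
    | succ n ih =>
      rw [Finset.sum_range_succ, ih, pow_succ]
      ring
  rw [h]
  have : (0 : ℝ) ≤ (1 / 4) ^ n := by positivity
  linarith

lemma IsConvexWeight.sum_comp_eq {i : ℕ → ℕ} (hi : StrictMono i) {u : ℕ → ℝ≥0∞}
    (hu : IsConvexWeight (Set.range i) u) :
    ∃ n, ∑ k ∈ Finset.range n, (u (i k)).toReal = 1 := by
  obtain ⟨n, hn⟩ := hu.bounded
  have h1 : ∑ k ∈ Finset.range n, u (i k) = 1 := by
    rw [← hu.tsum_eq, tsum_eq_sum (s := (Finset.range n).image i),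
      Finset.sum_image fun _ _ _ _ h => hi.injective h]
    intro m hm
    by_cases hmi : m ∈ Set.range i
    · obtain ⟨k, rfl⟩ := hmi
      refine hn _ ?_
      by_contra hlt
      refine hm (Finset.mem_image_of_mem _ (Finset.mem_range.2 ?_))
      exact (hi.le_apply (x := k)).trans_lt (not_le.1 hlt)
    · exact hu.supported m hmi
  refine ⟨n, ?_⟩
  rw [← ENNReal.toReal_sum, h1, ENNReal.toReal_one]
  intro k hk h
  have := Finset.single_le_sum (f := fun k => u (i k)) (fun _ _ => zero_le) hk
  rw [h1, h] at this
  simp at this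

lemma IsConvexWeight.le_one {L : Set ℕ} {u : ℕ → ℝ≥0∞} (hu : IsConvexWeight L u) (n : ℕ) :
    u n ≤ 1 := hu.tsum_eq ▸ ENNReal.le_tsum n

lemma exists_weight_eq_div {u : ℕ → ℝ≥0∞} {δ : ℝ} (hδ : 0 < δ)
    (hu : tsirelson F u ≤ ENNReal.ofReal δ) : ∃ ω, ∀ n, weight F ω n = (u n).toReal / δ := by
  obtain ⟨ω, hω⟩ := exists_weight_eq (F := F) ((ENNReal.ofReal δ)⁻¹ • u) fun n => by
    refine (tsirelson_mono (Set.indicator_le_self' fun _ _ => zero_le)).trans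
      ((tsirelson_smul_le _ _).trans ((mul_le_mul_right hu _).trans ?_))
    exact ENNReal.inv_mul_le_one _
  refine ⟨ω, fun n => ?_⟩
  rw [← ENNReal.toReal_ofReal (weight_nonneg (F := F) ω n), hω n, Pi.smul_apply, smul_eq_mul,
    ENNReal.toReal_mul, ENNReal.toReal_inv, ENNReal.toReal_ofReal hδ.le, inv_mul_eq_div]

/-- Lower estimate for the value of a combination of differences of generators with coefficients
close to `v k ^ p⁻¹`, at a point where the weights are `v k / δ`. -/
lemma le_sum_mul_cubeFun {p : ℝ} (hp : 1 < p) (hrp : r = 1 - p⁻¹) {i j : ℕ → ℕ}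
    {v a : ℕ → ℝ} {ω : CantorSpace} {δ : ℝ} (hδ : 0 < δ) (hv : ∀ k, 0 ≤ v k) (hv1 : ∀ k, v k ≤ 1)
    (ha : ∀ k, v k ^ p⁻¹ ≤ a k + (1 / 4) ^ (k + 1)) (hi : ∀ k, weight F ω (i k) = v k / δ)
    (hj : ∀ k, weight F ω (j k) = 0) {n : ℕ} (hn : ∑ k ∈ Finset.range n, v k = 1) :
    2 / 3 * (δ ^ r)⁻¹ ≤ ∑ k ∈ Finset.range n,
      a k * (cubeFun F r hr (i k) ω - cubeFun F r hr (j k) ω) := by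
  have hp1 := inv_lt_one_of_one_lt₀ hp
  have hr0 : r ≠ 0 := by
    rw [hrp]
    exact (sub_pos.2 hp1).ne'
  have hδr : 0 < (δ ^ r)⁻¹ := inv_pos.2 (Real.rpow_pos_of_pos hδ r)
  calc 2 / 3 * (δ ^ r)⁻¹ ≤ (∑ k ∈ Finset.range n, (v k - (1 / 4) ^ (k + 1))) * (δ ^ r)⁻¹ := by
        rw [Finset.sum_sub_distrib, hn]
        gcongr
        linarith [sum_quarter_pow_le n]
    _ = ∑ k ∈ Finset.range n, (v k - (1 / 4) ^ (k + 1)) * (δ ^ r)⁻¹ := Finset.sum_mul _ _ _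
    _ ≤ _ := by
        refine Finset.sum_le_sum fun k _ => ?_
        rw [cubeFun_apply, cubeFun_apply, hi, hj, Real.zero_rpow hr0, sub_zero,
          Real.div_rpow (hv k) hδ.le, div_eq_mul_inv (v k ^ r), ← mul_assoc]
        refine mul_le_mul_of_nonneg_right ?_ hδr.le
        have h1 : v k ^ p⁻¹ * v k ^ r = v k := by
          rw [← Real.rpow_add_of_nonneg (hv k) (by positivity) hr, hrp, add_sub_cancel,
            Real.rpow_one]
        have h2 : v k ^ r ≤ 1 := Real.rpow_le_one (hv k) (hv1 k) hr
        have h3 : 0 ≤ v k ^ r := Real.rpow_nonneg (hv k) r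
        have h4 : (0 : ℝ) ≤ (1 / 4) ^ (k + 1) := by positivity
        nlinarith [ha k]

lemma not_pAUSable_closedSpan (hF : IsRegularFamily F)
    (wf : ∀ M : Set ℕ, M.Infinite → ∃ A : Finset ℕ, ↑A ⊆ M ∧ A ∉ F) {p : ℝ} (hp : 1 < p)
    (hrp : r = 1 - p⁻¹) : ¬ PAUSable p (closedSpan (cubeFun F r hr)).1 := by
  rintro ⟨N, hN, C, hC, hρ⟩
  have hp0 : 0 < p := by linarith
  have hr0 : r ≠ 0 := by
    rw [hrp]
    exact (sub_pos.2 (inv_lt_one_of_one_lt₀ hp)).ne'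
  obtain ⟨hN1, a, ha, b, hb, hab⟩ := id hN
  set κ : ℝ := 1 / (4 * b) with hκ
  have hκ0 : 0 < κ := by positivity
  let g : ℕ → (closedSpan (cubeFun F r hr)).1 := fun n =>
    ⟨cubeFun F r hr n, cubeFun_mem_closedSpan n⟩
  have hf : ∀ n, N (κ • g n) ≤ 1 / 4 := by
    intro n
    have h0 : ‖g n‖ ≤ 1 := norm_cubeFun_le (hr := hr) n
    have h1 : N (g n) ≤ b * 1 := (hab (g n)).2.trans (mul_le_mul_of_nonneg_left h0 hb.le)
    rw [hN1.2.2.1, abs_of_pos hκ0]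
    calc κ * N (g n) ≤ κ * (b * 1) := by gcongr
      _ = 1 / 4 := by
        rw [hκ]
        field_simp
  obtain ⟨i, j, hij, hji, hest⟩ := exists_upper_estimate (not_finiteDimensional_closedSpan hr0) hN
    hC.le hρ hf grid fun k t ht => mem_grid_bounds ht
  have hi : StrictMono i := strictMono_nat_of_lt_succ fun k => (hij k).trans (hji k)
  have hj : ∀ k, j k ∉ Set.range i := by
    rintro k ⟨l, hl⟩
    have h1 : k < l := hi.lt_iff_lt.1 (hl ▸ hij k)
    have h2 : l < k + 1 := hi.lt_iff_lt.1 (hl ▸ hji k)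
    omega
  set K := Real.exp (C + 1)
  have hK : 0 < K := Real.exp_pos _
  set D := 2 * K / (a * κ) with hD
  have hD0 : 0 < D := by positivity
  set δ := D⁻¹ ^ r⁻¹ with hδdef
  have hδ : 0 < δ := Real.rpow_pos_of_pos (inv_pos.2 hD0) _
  have hδr : (δ ^ r)⁻¹ = D := by
    rw [hδdef, Real.rpow_inv_rpow (inv_pos.2 hD0).le hr0, inv_inv]
  obtain ⟨u, hu, huδ⟩ := exists_tsirelson_le hF wf (Set.infinite_range_of_injective hi.injective)
    (δ := ENNReal.ofReal δ) (by simpa using hδ)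
  obtain ⟨n, hn⟩ := hu.sum_comp_eq hi
  obtain ⟨ω, hω⟩ := exists_weight_eq_div hδ huδ
  have hv : ∀ k, 0 ≤ (u (i k)).toReal := fun _ => ENNReal.toReal_nonneg
  have hv1 : ∀ k, (u (i k)).toReal ≤ 1 := fun k =>
    ENNReal.toReal_mono ENNReal.one_ne_top (hu.le_one _)
  choose c hc hcle hlec using fun k => exists_mem_grid k (Real.rpow_nonneg (hv k) p⁻¹)
    (Real.rpow_le_one (hv k) (hv1 k) (inv_nonneg.2 hp0.le))
  have hlower := le_sum_mul_cubeFun (hr := hr) hp hrp (v := fun k => (u (i k)).toReal) hδ hv hv1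
    hlec (fun k => hω _) (j := j) (fun k => by rw [hω, hu.supported _ (hj k)]; simp) hn
  rw [hδr] at hlower
  set y := ∑ k ∈ Finset.range n, c k • (κ • g (i k) - κ • g (j k)) with hy
  have hNy : N y ≤ K := by
    refine (hest c hc n).trans (Real.exp_le_exp.2 ?_)
    have h1 : ∑ k ∈ Finset.range n, c k ^ p ≤ 1 := by
      rw [← hn]
      refine Finset.sum_le_sum fun k _ => ?_
      calc c k ^ p ≤ ((u (i k)).toReal ^ p⁻¹) ^ p :=
            Real.rpow_le_rpow (mem_grid_bounds (hc k)).1 (hcle k) hp0.le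
        _ = _ := Real.rpow_inv_rpow (hv k) hp0.ne'
    nlinarith
  have hyω : (y : CDelta) ω = κ * ∑ k ∈ Finset.range n,
      c k * (cubeFun F r hr (i k) ω - cubeFun F r hr (j k) ω) := by
    have h1 : (y : CDelta) = ∑ k ∈ Finset.range n,
        c k • (κ • cubeFun F r hr (i k) - κ • cubeFun F r hr (j k)) := by
      rw [hy, Submodule.coe_sum]
      rfl
    rw [h1, ContinuousMap.sum_apply, Finset.mul_sum]
    refine Finset.sum_congr rfl fun k _ => ?_
    rw [ContinuousMap.smul_apply, ContinuousMap.sub_apply, ContinuousMap.smul_apply,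
      ContinuousMap.smul_apply, smul_eq_mul, smul_eq_mul, smul_eq_mul]
    ring
  have h1 : κ * (2 / 3 * D) ≤ ‖y‖ := by
    calc κ * (2 / 3 * D) ≤ (y : CDelta) ω := by
          rw [hyω]
          gcongr
      _ ≤ ‖(y : CDelta)‖ := (le_abs_self _).trans ((y : CDelta).norm_coe_le_norm ω)
  have h2 : a * (κ * (2 / 3 * D)) ≤ K :=
    (mul_le_mul_of_nonneg_left h1 ha.le).trans ((hab y).1.trans hNy)
  have h3 : a * (κ * (2 / 3 * D)) = 4 / 3 * K := by
    rw [hD]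
    field_simp
    norm_num
  linarith

end NotSmooth

/-- For `p ∈ (1,∞)`, the class of separable Banach spaces admitting an equivalent `p`-AUS norm
is `Σ¹₁`-hard: every analytic subset of the Baire space is the preimage of it under some Borel
map into `SB`. -/
theorem pAUSable_class_is_analytic_hard (p : ℝ) (hp : 1 < p)
    (B : Set (ℕ → ℕ)) (hB : MeasureTheory.AnalyticSet B) :
    ∃ f : (ℕ → ℕ) → SB, Measurable f ∧
      f ⁻¹' { F : SB | PAUSable p (F.1 : Submodule ℝ CDelta) } = B := by
  obtain ⟨F, hF, hloc, hmem, hnot⟩ := exists_regular_families hB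
  have hr : 0 ≤ 1 - p⁻¹ := sub_nonneg.2 (inv_lt_one_of_one_lt₀ hp).le
  refine ⟨fun x => closedSpan (cubeFun (F x) (1 - p⁻¹) hr),
    measurable_closedSpan fun n => continuous_cubeFun hF hloc hr n, ?_⟩
  ext x
  rw [Set.mem_preimage, Set.mem_ofPred_eq]
  refine ⟨fun h => ?_, fun h => ?_⟩
  · by_contra hx
    exact not_pAUSable_closedSpan (hF x) (hnot x hx) hp rfl h
  · obtain ⟨b, hb, hbF⟩ := hmem x h
    exact pAUSable_closedSpan hb hbF hp rfl hr
end

section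
/- For every p ∈ (1,∞), the set A_p = {F ∈ SB : the Banach space F admits an equivalent p-AUS norm} is analytic (Σ¹₁): it is the projection onto SB of a Borel subset of SB × ℕ^ℕ (with respect to the product of the Effros–Borel σ-algebra and the Borel σ-algebra of the Baire space). -/
open Metric Set Topology Filter

section Norms

variable {X : Type*} [NormedAddCommGroup X] [NormedSpace ℝ X] {N : X → ℝ}

theorem IsNormFn.map_zero (hN : IsNormFn X N) : N 0 = 0 := (hN.2.1 0).2 rfl

/-- The seminorm underlying a norm function. -/
noncomputable def IsNormFn.toSeminorm (hN : IsNormFn X N) : Seminorm ℝ X :=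
  Seminorm.of N hN.2.2.2 fun a x => by rw [hN.2.2.1, Real.norm_eq_abs]

theorem IsNormFn.toSeminorm_apply (hN : IsNormFn X N) (x : X) : hN.toSeminorm x = N x := rfl

theorem IsEquivNorm.continuous (hN : IsEquivNorm X N) : Continuous N := by
  obtain ⟨h, _, _, b, hb, hab⟩ := hN
  have : LipschitzWith b.toNNReal N := by
    refine LipschitzWith.of_dist_le_mul fun x y => ?_
    rw [Real.dist_eq, Real.coe_toNNReal _ hb.le, dist_eq_norm]
    exact (abs_sub_map_le_sub h.toSeminorm x y).trans (hab _).2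
  exact this.continuous

/-- Pointwise form of the estimate `ρ̄(τ) ≤ C τ ^ p`. -/
def AUSBound (N : X → ℝ) (p C : ℝ) : Prop :=
  ∀ y, N y ≤ 1 → ∀ τ : ℝ, 0 ≤ τ → ∀ ε > 0, ∃ E : Submodule ℝ X, IsClosed (E : Set X) ∧
    FiniteDimensional ℝ (X ⧸ E) ∧ ∀ x ∈ E, N x ≤ 1 → N (y + τ • x) ≤ 1 + C * τ ^ p + ε

theorem IsNormFn.map_add_smul_le (hN : IsNormFn X N) {x y : X} (hy : N y ≤ 1) (hx : N x ≤ 1)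
    {τ : ℝ} (hτ : 0 ≤ τ) : N (y + τ • x) ≤ 1 + τ := by
  have h1 := hN.2.2.2 y (τ • x)
  rw [hN.2.2.1, abs_of_nonneg hτ] at h1
  have h2 := mul_le_mul_of_nonneg_left hx hτ
  linarith

private theorem sliceSup_bounds (hN : IsNormFn X N) {y : X} (hy : N y ≤ 1) {τ : ℝ} (hτ : 0 ≤ τ)
    (E : Submodule ℝ X) :
    BddAbove {t : ℝ | ∃ x ∈ E, N x ≤ 1 ∧ t = N (y + τ • x) - 1} ∧
      -1 ≤ sSup {t : ℝ | ∃ x ∈ E, N x ≤ 1 ∧ t = N (y + τ • x) - 1} ∧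
      sSup {t : ℝ | ∃ x ∈ E, N x ≤ 1 ∧ t = N (y + τ • x) - 1} ≤ τ := by
  have hub : ∀ t ∈ {t : ℝ | ∃ x ∈ E, N x ≤ 1 ∧ t = N (y + τ • x) - 1}, t ≤ τ := by
    rintro t ⟨x, -, hx, rfl⟩
    linarith [hN.map_add_smul_le hy hx hτ]
  have h0 : N y - 1 ∈ {t : ℝ | ∃ x ∈ E, N x ≤ 1 ∧ t = N (y + τ • x) - 1} :=
    ⟨0, E.zero_mem, by rw [hN.map_zero]; exact zero_le_one, by simp⟩
  refine ⟨⟨τ, hub⟩, ?_, csSup_le ⟨_, h0⟩ hub⟩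
  have := le_csSup ⟨τ, hub⟩ h0
  linarith [hN.1 y]

private theorem sliceInf_bddBelow (hN : IsNormFn X N) {y : X} (hy : N y ≤ 1) {τ : ℝ}
    (hτ : 0 ≤ τ) :
    BddBelow {s : ℝ | ∃ E : Submodule ℝ X, IsClosed (E : Set X) ∧
      FiniteDimensional ℝ (X ⧸ E) ∧
      s = sSup {t : ℝ | ∃ x ∈ E, N x ≤ 1 ∧ t = N (y + τ • x) - 1}} := by
  refine ⟨-1, ?_⟩
  rintro s ⟨E, -, -, rfl⟩
  exact (sliceSup_bounds hN hy hτ E).2.1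

theorem IsNormFn.ausBound_of_rhoN_le (hN : IsNormFn X N) {p C : ℝ} (hC : 0 ≤ C)
    (h : ∀ τ : ℝ, 0 ≤ τ → rhoN X N τ ≤ C * τ ^ p) : AUSBound N p C := by
  intro y hy τ hτ ε hε
  have hτp : 0 ≤ C * τ ^ p := mul_nonneg hC (Real.rpow_nonneg hτ p)
  by_cases hfin : FiniteDimensional ℝ X
  · refine ⟨⊥, (⊥ : Submodule ℝ X).closed_of_finiteDimensional, inferInstance, ?_⟩
    intro x hx _
    rw [(Submodule.mem_bot ℝ).1 hx, smul_zero, add_zero]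
    linarith
  · have hρ := h τ hτ
    rw [rhoN, if_neg hfin] at hρ
    have htop : τ ∈ upperBounds {r : ℝ | ∃ y : X, N y ≤ 1 ∧
      r = sInf { s : ℝ | ∃ E : Submodule ℝ X, IsClosed (E : Set X) ∧
            FiniteDimensional ℝ (X ⧸ E) ∧
            s = sSup { t : ℝ | ∃ x ∈ E, N x ≤ 1 ∧ t = N (y + τ • x) - 1 } }} := by
      rintro r ⟨z, hz, rfl⟩
      refine (csInf_le (sliceInf_bddBelow hN hz hτ) ⟨⊤, isClosed_univ, inferInstance, rfl⟩).trans
        (sliceSup_bounds hN hz hτ ⊤).2.2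
    have hy' := (le_csSup ⟨τ, htop⟩ ⟨y, hy, rfl⟩).trans hρ
    have hlt := hy'.trans_lt (lt_add_of_pos_right _ hε)
    obtain ⟨s, ⟨E, hE, hEf, rfl⟩, hs⟩ := exists_lt_of_csInf_lt
      (by exact ⟨_, (⊤ : Submodule ℝ X), isClosed_univ, inferInstance, rfl⟩) hlt
    refine ⟨E, hE, hEf, fun x hx hx1 => ?_⟩
    have := le_csSup (sliceSup_bounds hN hy hτ E).1 ⟨x, hx, hx1, rfl⟩
    linarith

theorem IsNormFn.rhoN_le_of_ausBound (hN : IsNormFn X N) {p C : ℝ} (hC : 0 ≤ C)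
    (h : AUSBound N p C) {τ : ℝ} (hτ : 0 ≤ τ) : rhoN X N τ ≤ C * τ ^ p := by
  have hτp : 0 ≤ C * τ ^ p := mul_nonneg hC (Real.rpow_nonneg hτ p)
  rw [rhoN]
  split_ifs with hfin
  · exact hτp
  · refine csSup_le ⟨_, 0, by rw [hN.map_zero]; exact zero_le_one, rfl⟩ ?_
    rintro r ⟨y, hy, rfl⟩
    refine le_of_forall_pos_le_add fun ε hε => ?_
    obtain ⟨E, hE, hEf, hb⟩ := h y hy τ hτ ε hε
    refine (csInf_le (sliceInf_bddBelow hN hy hτ) ⟨E, hE, hEf, rfl⟩).trans ?_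
    refine csSup_le ⟨_, 0, E.zero_mem, by rw [hN.map_zero]; exact zero_le_one, rfl⟩ ?_
    rintro t ⟨x, hx, hx1, rfl⟩
    linarith [hb x hx hx1]

/-- A closed subspace of finite codimension is, up to a small error, cut out by finitely many
small functionals. -/
theorem exists_functionals_near_submodule (E : Submodule ℝ X) (hE : IsClosed (E : Set X))
    [FiniteDimensional ℝ (X ⧸ E)] {η : ℝ} (hη : 0 < η) :
    ∃ (φ : ℕ → StrongDual ℝ X) (M : ℕ), (∀ i, ‖φ i‖ ≤ 1) ∧
      ∀ x, (∀ i < M, |φ i x| < 1 / ((M : ℝ) + 1)) → ∃ x' ∈ E, ‖x - x'‖ < η := by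
  have := hE
  let m := Module.finrank ℝ (X ⧸ E)
  let e : (X ⧸ E) ≃L[ℝ] (Fin m → ℝ) := (Module.finBasis ℝ (X ⧸ E)).equivFunL
  let π : X →L[ℝ] (X ⧸ E) := E.mkQL
  let T : X →L[ℝ] (Fin m → ℝ) := (e : (X ⧸ E) →L[ℝ] (Fin m → ℝ)).comp π
  let c : ℝ := ‖T‖ + 1
  have hc : 0 < c := by positivity
  let K : ℝ := (‖(e.symm : (Fin m → ℝ) →L[ℝ] (X ⧸ E))‖ + 1) * c
  have hK : 0 < K := by positivity
  obtain ⟨k, hk⟩ := exists_nat_one_div_lt (div_pos hη hK)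
  let φ : ℕ → StrongDual ℝ X := fun i =>
    if h : i < m then c⁻¹ • (ContinuousLinearMap.proj ⟨i, h⟩ : (Fin m → ℝ) →L[ℝ] ℝ).comp T else 0
  refine ⟨φ, max m k, fun i => ?_, fun x hx => ?_⟩
  · by_cases h : i < m
    · simp only [φ, dif_pos h]
      refine ContinuousLinearMap.opNorm_le_bound _ zero_le_one fun x => ?_
      have h1 : ‖T x ⟨i, h⟩‖ ≤ ‖T‖ * ‖x‖ := (norm_le_pi_norm _ _).trans (T.le_opNorm x)
      have h2 : ‖T x ⟨i, h⟩‖ ≤ c * ‖x‖ := h1.trans (by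
        gcongr; exact (lt_add_one _).le)
      simp only [smul_apply, ContinuousLinearMap.comp_apply,
        ContinuousLinearMap.proj_apply, norm_smul, norm_inv, Real.norm_of_nonneg hc.le, one_mul]
      rwa [inv_mul_le_iff₀ hc]
    · simp [φ, dif_neg h]
  · have hδ : (1 : ℝ) / (((max m k : ℕ) : ℝ) + 1) < η / K := by
      refine lt_of_le_of_lt ?_ hk
      gcongr
      exact le_max_right m k
    have hT : ‖T x‖ ≤ c * (η / K) := by
      refine (pi_norm_le_iff_of_nonneg (by positivity)).2 fun i => ?_
      have h1 := (hx i (i.2.trans_le (le_max_left _ _))).trans hδ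
      simp only [φ, dif_pos i.2, smul_apply, ContinuousLinearMap.comp_apply,
        ContinuousLinearMap.proj_apply, smul_eq_mul, abs_mul, abs_inv, abs_of_pos hc] at h1
      rw [inv_mul_lt_iff₀ hc] at h1
      exact h1.le
    have hπ : ‖π x‖ < η := by
      have h1 : π x = (e.symm : (Fin m → ℝ) →L[ℝ] (X ⧸ E)) (T x) := by simp [T]
      rw [h1]
      refine (ContinuousLinearMap.le_opNorm _ _).trans_lt ?_
      have h2 : c * (η / K) = η / (‖(e.symm : (Fin m → ℝ) →L[ℝ] (X ⧸ E))‖ + 1) := by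
        simp only [K]; field_simp
      rw [h2] at hT
      calc _ ≤ ‖(e.symm : (Fin m → ℝ) →L[ℝ] (X ⧸ E))‖ *
            (η / (‖(e.symm : (Fin m → ℝ) →L[ℝ] (X ⧸ E))‖ + 1)) := by gcongr
        _ < (‖(e.symm : (Fin m → ℝ) →L[ℝ] (X ⧸ E))‖ + 1) *
            (η / (‖(e.symm : (Fin m → ℝ) →L[ℝ] (X ⧸ E))‖ + 1)) := by
          gcongr; exact lt_add_one _
        _ = η := by field_simp
    obtain ⟨z, hz, hzn⟩ := Submodule.Quotient.norm_mk_lt (π x) (sub_pos.2 hπ)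
    refine ⟨x - z, ?_, by simpa using hzn⟩
    rw [← Submodule.Quotient.mk_eq_zero, Submodule.Quotient.mk_sub, hz]
    exact sub_self _

theorem IsEquivNorm.exists_functionals (hN : IsEquivNorm X N) {p C : ℝ} (h : AUSBound N p C)
    {y : X} (hy : N y ≤ 1) {τ : ℝ} (hτ : 0 ≤ τ) {ε : ℝ} (hε : 0 < ε) :
    ∃ (φ : ℕ → StrongDual ℝ X) (M : ℕ), (∀ i, ‖φ i‖ ≤ 1) ∧
      ∀ x, N x ≤ 1 → (∀ i < M, |φ i x| < 1 / ((M : ℝ) + 1)) →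
        N (y + τ • x) ≤ 1 + C * τ ^ p + ε := by
  obtain ⟨hn, _, _, b, hb, hab⟩ := hN
  obtain ⟨E, hE, hEf, hEb⟩ := h y hy τ hτ (ε / 2) (half_pos hε)
  have hη : 0 < ε / (4 * b * (τ + 1)) := by positivity
  set η := ε / (4 * b * (τ + 1)) with hη_def
  obtain ⟨φ, M, hφ, hM⟩ := exists_functionals_near_submodule E hE hη
  refine ⟨φ, M, hφ, fun x hx hxM => ?_⟩
  obtain ⟨x', hx', hxx'⟩ := hM x hxM
  have hbη : 0 < b * η := mul_pos hb hη
  have hd : N (x - x') ≤ b * η := (hab _).2.trans (by gcongr)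
  have hd' : N (x' - x) ≤ b * η := (hab _).2.trans (by rw [norm_sub_rev]; gcongr)
  have hx'1 : N x' ≤ 1 + b * η := by
    have := hn.2.2.2 x (x' - x)
    rw [add_sub_cancel] at this
    linarith
  set s := (1 + b * η)⁻¹ with hs
  have hs0 : 0 < s := by positivity
  have hsx : N (s • x') ≤ 1 := by
    rw [hn.2.2.1, abs_of_pos hs0, hs, inv_mul_le_iff₀ (by positivity)]
    simpa using hx'1
  have hxs : N (x' - s • x') ≤ b * η := by
    have h1 : x' - s • x' = (1 - s) • x' := by rw [sub_smul, one_smul]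
    have h2 : s * (1 + b * η) = 1 := inv_mul_cancel₀ (by positivity)
    have h3 : 0 ≤ 1 - s := by nlinarith
    rw [h1, hn.2.2.1, abs_of_nonneg h3]
    calc (1 - s) * N x' ≤ (1 - s) * (1 + b * η) := by gcongr
      _ = b * η := by linarith
  have h1 := hEb _ (E.smul_mem s hx') hsx
  have h2 : y + τ • x = (y + τ • s • x') + τ • ((x - x') + (x' - s • x')) := by
    simp only [smul_add, smul_sub]; abel
  have h3 := hn.2.2.2 (y + τ • s • x') (τ • ((x - x') + (x' - s • x')))
  have h4 := hn.2.2.2 (x - x') (x' - s • x')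
  rw [hn.2.2.1, abs_of_nonneg hτ] at h3
  rw [h2]
  have h5 : τ * N ((x - x') + (x' - s • x')) ≤ τ * (2 * (b * η)) := by
    gcongr; linarith
  have h6 : τ * (2 * (b * η)) ≤ ε / 2 := by
    have : (τ + 1) * (2 * (b * η)) = ε / 2 := by rw [hη_def]; field_simp; norm_num
    nlinarith
  linarith

/-- The seminorm `b * sup |g n x|`. -/
noncomputable def supNormFn (b : ℕ) (g : ℕ → StrongDual ℝ X) (x : X) : ℝ := b * ⨆ n, |g n x|

theorem bddAbove_functionals {g : ℕ → StrongDual ℝ X} (hg : ∀ n, ‖g n‖ ≤ 1) (x : X) :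
    BddAbove (range fun n => |g n x|) := by
  refine ⟨‖x‖, ?_⟩
  rintro _ ⟨n, rfl⟩
  exact ((g n).le_of_opNorm_le (hg n) x).trans (one_mul _).le

theorem abs_le_supNormFn {g : ℕ → StrongDual ℝ X} (hg : ∀ n, ‖g n‖ ≤ 1) (b : ℕ) (n : ℕ) (x : X) :
    b * |g n x| ≤ supNormFn b g x := by
  unfold supNormFn
  gcongr
  exact le_ciSup (bddAbove_functionals hg x) n

theorem supNormFn_nonneg (b : ℕ) (g : ℕ → StrongDual ℝ X) (x : X) : 0 ≤ supNormFn b g x :=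
  mul_nonneg b.cast_nonneg (Real.iSup_nonneg fun _ => abs_nonneg _)

theorem supNormFn_le_of_forall {b : ℕ} {g : ℕ → StrongDual ℝ X} {x : X} {r : ℝ}
    (h : ∀ n, b * |g n x| ≤ r) : supNormFn b g x ≤ r := by
  rw [supNormFn, Real.mul_iSup_of_nonneg b.cast_nonneg]
  exact ciSup_le h

theorem supNormFn_le {g : ℕ → StrongDual ℝ X} (hg : ∀ n, ‖g n‖ ≤ 1) (b : ℕ) (x : X) :
    supNormFn b g x ≤ b * ‖x‖ :=
  supNormFn_le_of_forall fun n => by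
    gcongr; exact ((g n).le_of_opNorm_le (hg n) x).trans (one_mul _).le

theorem supNormFn_add {g : ℕ → StrongDual ℝ X} (hg : ∀ n, ‖g n‖ ≤ 1) (b : ℕ) (x y : X) :
    supNormFn b g (x + y) ≤ supNormFn b g x + supNormFn b g y := by
  refine supNormFn_le_of_forall fun n => ?_
  have h1 := abs_le_supNormFn hg b n x
  have h2 := abs_le_supNormFn hg b n y
  have h3 : (b : ℝ) * |g n (x + y)| ≤ b * (|g n x| + |g n y|) := by
    rw [map_add]; gcongr; exact abs_add_le _ _
  linarith

theorem supNormFn_smul (b : ℕ) (g : ℕ → StrongDual ℝ X) (a : ℝ) (x : X) :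
    supNormFn b g (a • x) = |a| * supNormFn b g x := by
  simp only [supNormFn, map_smul, smul_eq_mul, abs_mul]
  rw [← Real.mul_iSup_of_nonneg (abs_nonneg a)]
  ring

theorem continuous_supNormFn {g : ℕ → StrongDual ℝ X} (hg : ∀ n, ‖g n‖ ≤ 1) (b : ℕ) :
    Continuous (supNormFn b g) := by
  let q : Seminorm ℝ X := Seminorm.of (supNormFn b g) (supNormFn_add hg b)
    fun a x => by rw [supNormFn_smul, Real.norm_eq_abs]
  have : LipschitzWith b (supNormFn b g) := by
    refine LipschitzWith.of_dist_le_mul fun x y => ?_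
    rw [Real.dist_eq, dist_eq_norm]
    exact (abs_sub_map_le_sub q x y).trans (supNormFn_le hg b _)
  exact this.continuous

theorem isEquivNorm_supNormFn {d : ℕ → X} (hd : DenseRange d) {g : ℕ → StrongDual ℝ X}
    (hg : ∀ n, ‖g n‖ ≤ 1) {a b : ℕ} (h : ∀ n, ‖d n‖ ≤ a * supNormFn b g (d n)) :
    IsEquivNorm X (supNormFn b g) := by
  have hall : ∀ x, ‖x‖ ≤ a * supNormFn b g x := fun x =>
    hd.induction_on (p := fun x => ‖x‖ ≤ a * supNormFn b g x) x
      (isClosed_le continuous_norm (continuous_const.mul (continuous_supNormFn hg b))) h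
  refine ⟨⟨supNormFn_nonneg b g, fun x => ⟨fun hx => ?_, ?_⟩, supNormFn_smul b g,
    supNormFn_add hg b⟩, ((a : ℝ) + 1)⁻¹, by positivity, (b : ℝ) + 1, by positivity,
    fun x => ⟨?_, ?_⟩⟩
  · have := hall x
    rw [hx, mul_zero] at this
    exact norm_le_zero_iff.1 this
  · rintro rfl
    simpa using supNormFn_smul b g 0 (0 : X)
  · rw [inv_mul_le_iff₀ (by positivity)]
    nlinarith [hall x, supNormFn_nonneg b g x]
  · nlinarith [supNormFn_le hg b x, norm_nonneg x]

theorem IsEquivNorm.exists_supNormFn_eq (hN : IsEquivNorm X N) {d : ℕ → X} (hd : DenseRange d) :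
    ∃ (b : ℕ) (g : ℕ → StrongDual ℝ X), (∀ n, ‖g n‖ ≤ 1) ∧ supNormFn b g = N := by
  have hcont := hN.continuous
  obtain ⟨hn, _, _, b₀, hb₀, hab⟩ := hN
  obtain ⟨b, hb⟩ := exists_nat_gt b₀
  have hbpos : (0 : ℝ) < b := hb₀.trans hb
  have key : ∀ n, ∃ g : StrongDual ℝ X, ‖g‖ ≤ 1 ∧ (∀ x, b * |g x| ≤ N x) ∧
      b * |g (d n)| = N (d n) := by
    intro n
    by_cases h0 : d n = 0
    · refine ⟨0, by simp, fun x => by simpa using hn.1 x, by simp [h0, hn.map_zero]⟩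
    let u : Module.Dual ℝ (Submodule.span ℝ {d n}) :=
      N (d n) • (LinearEquiv.toSpanNonzeroSingleton ℝ X (d n) h0).symm.toLinearMap
    have hu : ∀ x, u x ≤ hn.toSeminorm x := by
      intro x
      obtain ⟨t, rfl⟩ := (LinearEquiv.toSpanNonzeroSingleton ℝ X (d n) h0).surjective x
      simp only [u, LinearMap.smul_apply, LinearEquiv.coe_coe, LinearEquiv.symm_apply_apply]
      simp only [LinearEquiv.toSpanNonzeroSingleton_apply, hn.toSeminorm_apply, smul_eq_mul,
        hn.2.2.1]
      rw [mul_comm]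
      exact mul_le_mul_of_nonneg_right (le_abs_self t) (hn.1 _)
    obtain ⟨G, hGu, hGN⟩ := Module.Dual.exists_continuous_extension_of_le_seminorm_real
      _ u (p := hn.toSeminorm) hcont hu
    have hGd : G (d n) = N (d n) := by
      have h1 := hGu (LinearEquiv.toSpanNonzeroSingleton ℝ X (d n) h0 1)
      simp only [u, LinearMap.smul_apply, LinearEquiv.coe_coe, LinearEquiv.symm_apply_apply] at h1
      simpa using h1
    have hbG : ∀ x, (b : ℝ) * |((b : ℝ)⁻¹ • G) x| = |G x| := by
      intro x
      rw [smul_apply, smul_eq_mul, abs_mul, abs_inv, abs_of_pos hbpos,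
        mul_inv_cancel_left₀ hbpos.ne']
    refine ⟨(b : ℝ)⁻¹ • G, ?_, fun x => (hbG x).trans_le (hGN x), ?_⟩
    · refine ContinuousLinearMap.opNorm_le_bound _ zero_le_one fun x => ?_
      have h1 := (hbG x).trans_le ((hGN x).trans (hab x).2)
      rw [Real.norm_eq_abs, one_mul]
      refine le_of_mul_le_mul_left (h1.trans ?_) hbpos
      gcongr
    · rw [hbG, hGd, abs_of_nonneg (hn.1 _)]
  choose g hg1 hg2 hg3 using key
  refine ⟨b, g, hg1, ?_⟩
  refine hd.equalizer (continuous_supNormFn hg1 b) hcont (funext fun n => le_antisymm ?_ ?_)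
  · exact supNormFn_le_of_forall fun m => hg2 m _
  · exact (hg3 n).symm.trans_le (abs_le_supNormFn hg1 b n _)

/-- `(d, g, f)` encodes a `p`-AUS norm on the closure of the range of `d`: the norm is a multiple
of `sup |g n|`, and the functionals `f` describe the subspaces of finite codimension. -/
def IsPAUSCode (p : ℝ) (d : ℕ → X) (g : ℕ → StrongDual ℝ X)
    (f : ℕ × ℚ × ℕ → ℕ → StrongDual ℝ X) : Prop :=
  ∃ a b c : ℕ, (∀ n, ‖d n‖ ≤ a * supNormFn b g (d n)) ∧
    ∀ t : ℕ × ℚ × ℕ, supNormFn b g (d t.1) ≤ 1 → 0 ≤ t.2.1 → ∃ M : ℕ, ∀ n,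
      supNormFn b g (d n) ≤ 1 → (∀ i < M, |f t i (d n)| < 1 / ((M : ℝ) + 1)) →
        supNormFn b g (d t.1 + (t.2.1 : ℝ) • d n) ≤
          1 + c * (t.2.1 : ℝ) ^ p + 1 / ((t.2.2 : ℝ) + 1)

theorem PAUSable.exists_isPAUSCode {p : ℝ} (h : PAUSable p X) {d : ℕ → X} (hd : DenseRange d) :
    ∃ (g : ℕ → StrongDual ℝ X) (f : ℕ × ℚ × ℕ → ℕ → StrongDual ℝ X),
      (∀ n, ‖g n‖ ≤ 1) ∧ (∀ t i, ‖f t i‖ ≤ 1) ∧ IsPAUSCode p d g f := by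
  obtain ⟨N, hN, C, hC, hrho⟩ := h
  have hB := hN.1.ausBound_of_rhoN_le hC.le hrho
  obtain ⟨b, g, hg, hbg⟩ := hN.exists_supNormFn_eq hd
  obtain ⟨c, hc⟩ := exists_nat_gt C
  have key : ∀ t : ℕ × ℚ × ℕ, ∃ φ : ℕ → StrongDual ℝ X, (∀ i, ‖φ i‖ ≤ 1) ∧
      (N (d t.1) ≤ 1 → 0 ≤ t.2.1 → ∃ M : ℕ, ∀ x, N x ≤ 1 →
        (∀ i < M, |φ i x| < 1 / ((M : ℝ) + 1)) →
        N (d t.1 + (t.2.1 : ℝ) • x) ≤ 1 + C * (t.2.1 : ℝ) ^ p + 1 / ((t.2.2 : ℝ) + 1)) := by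
    intro t
    by_cases ht : N (d t.1) ≤ 1 ∧ 0 ≤ t.2.1
    · obtain ⟨φ, M, hφ, hM⟩ := hN.exists_functionals hB ht.1 (Rat.cast_nonneg.2 ht.2)
        (Nat.one_div_pos_of_nat (α := ℝ) (n := t.2.2))
      exact ⟨φ, hφ, fun _ _ => ⟨M, hM⟩⟩
    · exact ⟨0, by simp, fun h1 h2 => absurd ⟨h1, h2⟩ ht⟩
  choose f hf1 hf2 using key
  obtain ⟨-, a, ha, _, _, hab⟩ := hN
  obtain ⟨a', ha'⟩ := exists_nat_gt a⁻¹
  refine ⟨g, f, hg, hf1, a', b, c, fun n => ?_, fun t h1 h2 => ?_⟩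
  · rw [hbg]
    have h1 := (hab (d n)).1
    have h2 : ‖d n‖ ≤ a⁻¹ * N (d n) := by rwa [← div_eq_inv_mul, le_div_iff₀' ha]
    refine h2.trans (mul_le_mul_of_nonneg_right ha'.le ?_)
    exact (by positivity : 0 ≤ a * ‖d n‖).trans h1
  · rw [hbg] at h1 ⊢
    obtain ⟨M, hM⟩ := hf2 t h1 h2
    refine ⟨M, fun n hn1 hn2 => (hM (d n) hn1 hn2).trans ?_⟩
    have : (0 : ℝ) ≤ (t.2.1 : ℝ) := Rat.cast_nonneg.2 h2
    gcongr

theorem IsPAUSCode.pausable {p : ℝ} (hp : 0 < p) {d : ℕ → X} (hd : DenseRange d)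
    {g : ℕ → StrongDual ℝ X} {f : ℕ × ℚ × ℕ → ℕ → StrongDual ℝ X} (hg : ∀ n, ‖g n‖ ≤ 1)
    (h : IsPAUSCode p d g f) : PAUSable p X := by
  obtain ⟨a, b, c, hlow, hcode⟩ := h
  have hN := isEquivNorm_supNormFn hd hg hlow
  have hNc := continuous_supNormFn hg b
  set N := supNormFn b g with hNdef
  refine ⟨N, hN, (c : ℝ) + 1, by positivity, fun τ hτ =>
    hN.1.rhoN_le_of_ausBound (by positivity) ?_ hτ⟩
  clear τ hτ
  intro y hy τ hτ ε hε
  obtain ⟨hn, -⟩ := hN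
  -- approximation of the vector `y`
  obtain ⟨m, hm1, hmy⟩ : ∃ m, N (d m) ≤ 1 ∧ N (y - d m) < ε / 4 := by
    let r : ℝ := (1 + ε / 8)⁻¹
    have hr0 : 0 < r := by positivity
    have hr1 : r < 1 := inv_lt_one_of_one_lt₀ (by linarith)
    have hr2 : 1 - r < ε / 8 := by
      have : r * (1 + ε / 8) = 1 := inv_mul_cancel₀ (by positivity)
      nlinarith
    have hU : IsOpen {z | N z < 1 ∧ N (r • y - z) < ε / 8} :=
      (isOpen_lt hNc continuous_const).inter
        (isOpen_lt (hNc.comp (continuous_const.sub continuous_id)) continuous_const)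
    obtain ⟨m, hm⟩ := hd.exists_mem_open hU ⟨r • y, by
      rw [hn.2.2.1, abs_of_pos hr0]
      nlinarith, by rw [sub_self, hn.map_zero]; positivity⟩
    refine ⟨m, hm.1.le, ?_⟩
    have h1 : y - d m = (1 - r) • y + (r • y - d m) := by rw [sub_smul, one_smul]; abel
    have h2 := hn.2.2.2 ((1 - r) • y) (r • y - d m)
    rw [hn.2.2.1, abs_of_pos (sub_pos.2 hr1)] at h2
    rw [h1]
    have h3 : (1 - r) * N y ≤ (1 - r) * 1 := mul_le_mul_of_nonneg_left hy (sub_pos.2 hr1).le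
    linarith [hm.2]
  -- approximation of the parameter `τ`
  obtain ⟨q, hq0, hqτ, hqp⟩ : ∃ q : ℚ, 0 ≤ q ∧ |τ - q| < ε / 4 ∧
      c * (q : ℝ) ^ p < c * τ ^ p + ε / 4 := by
    have hcont : Continuous fun s : ℝ => (c : ℝ) * s ^ p :=
      continuous_const.mul (Real.continuous_rpow_const hp.le)
    have h1 : ∀ᶠ s in 𝓝[>] τ, (c : ℝ) * s ^ p < c * τ ^ p + ε / 4 :=
      (hcont.tendsto τ).mono_left nhdsWithin_le_nhds |>.eventually_lt_const (by linarith)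
    obtain ⟨u, hu, hu'⟩ := (mem_nhdsGT_iff_exists_Ioo_subset).1 h1
    obtain ⟨q, hq1, hq2⟩ := exists_rat_btwn
      (lt_min (mem_Ioi.1 hu) (lt_add_of_pos_right τ (by positivity : 0 < ε / 4)))
    refine ⟨q, by exact_mod_cast hτ.trans hq1.le, ?_, hu' ⟨hq1, hq2.trans_le (min_le_left _ _)⟩⟩
    have := hq2.trans_le (min_le_right _ _)
    rw [abs_sub_comm, abs_of_pos (sub_pos.2 hq1)]
    linarith
  obtain ⟨k, hk⟩ := exists_nat_one_div_lt (by positivity : 0 < ε / 4)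
  obtain ⟨M, hM⟩ := hcode (m, q, k) hm1 hq0
  let T : X →L[ℝ] (Fin M → ℝ) := ContinuousLinearMap.pi fun i => f (m, q, k) i
  refine ⟨T.ker, T.isClosed_ker,
    Module.Finite.equiv (T.toLinearMap.quotKerEquivRange).symm, fun x hx hx1 => ?_⟩
  have hxf : ∀ i < M, f (m, q, k) i x = 0 := fun i hi =>
    congrFun (LinearMap.mem_ker.1 hx) ⟨i, hi⟩
  let O : Set X := {z | N z < 1} ∩ ⋂ i : Fin M, {z | |f (m, q, k) i z| < 1 / ((M : ℝ) + 1)}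
  have hO : IsOpen O := (isOpen_lt hNc continuous_const).inter
    (isOpen_iInter_of_finite fun i => isOpen_lt (f (m, q, k) i).continuous.abs continuous_const)
  let S : Set X := {z | N (d m + (q : ℝ) • z) ≤ 1 + c * (q : ℝ) ^ p + 1 / ((k : ℝ) + 1)}
  have hS : IsClosed S := isClosed_le
    (hNc.comp (continuous_const.add (continuous_const.smul continuous_id))) continuous_const
  have hOS : O ⊆ S := by
    refine (hd.open_subset_closure_inter hO).trans (closure_minimal ?_ hS)
    rintro _ ⟨hz, n, rfl⟩
    exact hM n (le_of_lt hz.1) fun i hi => mem_iInter.1 hz.2 ⟨i, hi⟩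
  have hxS : x ∈ S := by
    have hlim : Tendsto (fun s : ℝ => s • x) (𝓝[<] 1) (𝓝 x) := by
      have : Tendsto (fun s : ℝ => s • x) (𝓝 1) (𝓝 ((1 : ℝ) • x)) :=
        (continuous_id.smul continuous_const).tendsto 1
      rw [one_smul] at this
      exact this.mono_left nhdsWithin_le_nhds
    refine hS.mem_of_tendsto hlim ?_
    filter_upwards [Ioo_mem_nhdsLT (zero_lt_one' ℝ)] with s hs
    refine hOS ⟨?_, mem_iInter.2 fun i => ?_⟩
    · change N (s • x) < 1
      rw [hn.2.2.1, abs_of_pos hs.1]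
      nlinarith [hs.1, hs.2]
    · change |f (m, q, k) i (s • x)| < 1 / ((M : ℝ) + 1)
      rw [map_smul, hxf i i.2, smul_zero, abs_zero]
      positivity
  have h1 : N (d m + (q : ℝ) • x) ≤ 1 + c * (q : ℝ) ^ p + 1 / ((k : ℝ) + 1) := hxS
  have h2 : y + τ • x = (d m + (q : ℝ) • x) + ((y - d m) + (τ - q) • x) := by
    rw [sub_smul]; abel
  have h3 := hn.2.2.2 (d m + (q : ℝ) • x) ((y - d m) + (τ - q) • x)
  have h4 := hn.2.2.2 (y - d m) ((τ - q) • x)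
  rw [hn.2.2.1] at h4
  have h5 : |τ - q| * N x ≤ |τ - q| * 1 := mul_le_mul_of_nonneg_left hx1 (abs_nonneg _)
  have h6 : (0 : ℝ) ≤ τ ^ p := Real.rpow_nonneg hτ p
  rw [h2]
  linarith

end Norms

section Subspace

variable {E : Type*} [NormedAddCommGroup E] [NormedSpace ℝ E]

theorem isPAUSCode_coe_iff {p : ℝ} {F : Submodule ℝ E} {d : ℕ → F} {g : ℕ → StrongDual ℝ F}
    {f : ℕ × ℚ × ℕ → ℕ → StrongDual ℝ F} {G : ℕ → StrongDual ℝ E}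
    {H : ℕ × ℚ × ℕ → ℕ → StrongDual ℝ E} (hG : ∀ n (x : F), G n x = g n x)
    (hH : ∀ t i (x : F), H t i x = f t i x) :
    IsPAUSCode p (fun n => (d n : E)) G H ↔ IsPAUSCode p d g f := by
  have hs : ∀ b (x : F), supNormFn b G (x : E) = supNormFn b g x := fun b x => by
    simp only [supNormFn, hG]
  simp only [IsPAUSCode, ← Submodule.coe_smul, ← Submodule.coe_add, hs, hH, Submodule.coe_norm]

theorem mem_iff_forall_exists_ball {q : ℕ → E} (hq : DenseRange q) {F : Submodule ℝ E}
    (hF : IsClosed (F : Set E)) (x : E) :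
    x ∈ F ↔ ∀ k : ℕ, ∃ j, dist x (q j) < 1 / ((k : ℝ) + 1) ∧
      ((F : Set E) ∩ ball (q j) (1 / ((k : ℝ) + 1))).Nonempty := by
  constructor
  · intro hx k
    obtain ⟨j, hj⟩ := Metric.denseRange_iff.1 hq x (1 / ((k : ℝ) + 1)) Nat.one_div_pos_of_nat
    exact ⟨j, hj, x, hx, hj⟩
  · intro h
    rw [← SetLike.mem_coe, ← hF.closure_eq, Metric.mem_closure_iff]
    intro ε hε
    obtain ⟨k, hk⟩ := exists_nat_one_div_lt (half_pos hε)
    obtain ⟨j, hj, y, hy, hyj⟩ := h k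
    refine ⟨y, hy, ?_⟩
    have := dist_triangle_right x y (q j)
    rw [mem_ball] at hyj
    linarith

theorem denseRange_iff_forall_ball {q : ℕ → E} (hq : DenseRange q) {F : Submodule ℝ E}
    (d : ℕ → F) :
    DenseRange d ↔ ∀ j k : ℕ, ((F : Set E) ∩ ball (q j) (1 / ((k : ℝ) + 1))).Nonempty →
      ∃ n, dist (d n : E) (q j) < 1 / ((k : ℝ) + 1) := by
  constructor
  · rintro hd j k ⟨x, hx, hxj⟩
    exact hd.exists_mem_open
      (isOpen_ball.preimage (continuous_subtype_val : Continuous ((↑) : F → E))) ⟨⟨x, hx⟩, hxj⟩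
  · intro h
    refine Metric.denseRange_iff.2 fun x r hr => ?_
    obtain ⟨k, hk⟩ := exists_nat_one_div_lt (half_pos hr)
    obtain ⟨j, hj⟩ := Metric.denseRange_iff.1 hq (x : E) (1 / ((k : ℝ) + 1))
      Nat.one_div_pos_of_nat
    obtain ⟨n, hn⟩ := h j k ⟨x, x.2, hj⟩
    refine ⟨n, ?_⟩
    rw [Subtype.dist_eq]
    have := dist_triangle_right (x : E) (d n) (q j)
    linarith

end Subspace

theorem polishSpace_pi (ι A : Type*) [Countable ι] [TopologicalSpace A] [PolishSpace A] :
    PolishSpace (ι → A) :=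
  inferInstance

theorem polishSpace_prod (A B : Type*) [TopologicalSpace A] [PolishSpace A] [TopologicalSpace B]
    [PolishSpace B] : PolishSpace (A × B) :=
  inferInstance

/-- The closed unit ball of the dual of `E` with the weak-* topology. -/
abbrev WeakDualBall (E : Type*) [NormedAddCommGroup E] [NormedSpace ℝ E] : Type _ :=
  (WeakDual.toStrongDual ⁻¹' closedBall (0 : StrongDual ℝ E) 1 : Set (WeakDual ℝ E))

namespace WeakDualBall

variable {E : Type*} [NormedAddCommGroup E] [NormedSpace ℝ E]

/-- The functional underlying a point of the dual ball. -/
noncomputable def toDual (φ : WeakDualBall E) : StrongDual ℝ E := WeakDual.toStrongDual φ.1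

theorem norm_toDual_le (φ : WeakDualBall E) : ‖φ.toDual‖ ≤ 1 := mem_closedBall_zero_iff.1 φ.2

theorem exists_toDual_extension (F : Submodule ℝ E) {φ : StrongDual ℝ F} (hφ : ‖φ‖ ≤ 1) :
    ∃ ψ : WeakDualBall E, ∀ x : F, ψ.toDual x = φ x := by
  obtain ⟨ψ, hψ, hn⟩ := exists_extension_norm_eq F φ
  exact ⟨⟨StrongDual.toWeakDual ψ, mem_closedBall_zero_iff.2 (hn.trans_le hφ)⟩, hψ⟩

instance : Nonempty (WeakDualBall E) :=
  ⟨⟨0, mem_closedBall_zero_iff.2 (by simp)⟩⟩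

theorem continuous_eval : Continuous fun z : WeakDualBall E × E => z.1.toDual z.2 := by
  refine continuous_prod_of_continuous_lipschitzWith'
    (fun z : WeakDualBall E × E => z.1.toDual z.2) 1 (fun φ => ?_) fun x => ?_
  · exact φ.toDual.lipschitz.weaken φ.norm_toDual_le
  · exact (WeakDual.eval_continuous x).comp continuous_subtype_val

instance [TopologicalSpace.SeparableSpace E] : PolishSpace (WeakDualBall E) := by
  have hK := WeakDual.isCompact_closedBall (0 : StrongDual ℝ E) 1
  have : CompactSpace (WeakDualBall E) := isCompact_iff_compactSpace.1 hK
  have : TopologicalSpace.MetrizableSpace (WeakDualBall E) :=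
    WeakDual.metrizable_of_isCompact ℝ E _ hK
  let := TopologicalSpace.metrizableSpaceMetric (WeakDualBall E)
  infer_instance

end WeakDualBall

section Measurability

variable {E Y : Type*} [NormedAddCommGroup E] [NormedSpace ℝ E] [TopologicalSpace Y]
  [MeasurableSpace Y] [OpensMeasurableSpace Y]

theorem measurable_supNormFn {g : Y → ℕ → WeakDualBall E} (hg : ∀ n, Continuous fun y => g y n)
    {v : Y → E} (hv : Continuous v) (b : ℕ) :
    Measurable fun y => supNormFn b (fun n => (g y n).toDual) (v y) :=
  measurable_const.mul <| .iSup fun n =>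
    (WeakDualBall.continuous_eval.comp ((hg n).prodMk hv)).abs.measurable

theorem measurable_isPAUSCode (p : ℝ) {d : Y → ℕ → E} {g : Y → ℕ → WeakDualBall E}
    {f : Y → ℕ × ℚ × ℕ → ℕ → WeakDualBall E} (hd : ∀ n, Continuous fun y => d y n)
    (hg : ∀ n, Continuous fun y => g y n) (hf : ∀ t i, Continuous fun y => f y t i) :
    Measurable fun y =>
      IsPAUSCode p (d y) (fun n => (g y n).toDual) fun t i => (f y t i).toDual := by
  have hle : ∀ {u v : Y → ℝ}, Measurable u → Measurable v → Measurable fun y => u y ≤ v y :=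
    fun hu hv => measurableSet_setOfPred.1 (measurableSet_le hu hv)
  have hlt : ∀ {u v : Y → ℝ}, Measurable u → Measurable v → Measurable fun y => u y < v y :=
    fun hu hv => measurableSet_setOfPred.1 (measurableSet_lt hu hv)
  refine .exists fun a => .exists fun b => .exists fun c => .and (.forall fun n => ?_)
    (.forall fun t => .imp ?_ <| .imp measurable_const <| .exists fun M => .forall fun n =>
      .imp ?_ <| .imp (.forall fun i => .imp measurable_const ?_) ?_)
  · exact hle (hd n).norm.measurable (measurable_const.mul (measurable_supNormFn hg (hd n) b))
  · exact hle (measurable_supNormFn hg (hd _) b) measurable_const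
  · exact hle (measurable_supNormFn hg (hd n) b) measurable_const
  · exact hlt (WeakDualBall.continuous_eval.comp ((hf t i).prodMk (hd n))).abs.measurable
      measurable_const
  · exact hle (measurable_supNormFn hg ((hd _).add ((hd n).const_smul _)) b) measurable_const

end Measurability

theorem SB.measurable_inter_nonempty {U : Set CDelta} (hU : IsOpen U) :
    Measurable fun F : SB => (((F.1 : Submodule ℝ CDelta) : Set CDelta) ∩ U).Nonempty :=
  measurableSet_setOfPred.1 (MeasurableSpace.measurableSet_generateFrom ⟨U, hU, rfl⟩)

/-- For `p ∈ (1,∞)`, the class of spaces in `SB` admitting an equivalent `p`-AUS norm is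
analytic: it is the projection onto `SB` of a Borel subset of `SB × ℕ^ℕ`. -/
theorem pAUSable_class_is_analytic (p : ℝ) (hp : 1 < p) :
    ∃ D : Set (SB × (ℕ → ℕ)), MeasurableSet D ∧
      { F : SB | PAUSable p (F.1 : Submodule ℝ CDelta) } = Prod.fst '' D := by
  have := polishSpace_pi ℕ CDelta
  have := polishSpace_pi (ℕ × ℚ × ℕ) (ℕ → WeakDualBall CDelta)
  have := polishSpace_prod (ℕ → WeakDualBall CDelta) (ℕ × ℚ × ℕ → ℕ → WeakDualBall CDelta)
  have := polishSpace_prod (ℕ → CDelta)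
    ((ℕ → WeakDualBall CDelta) × (ℕ × ℚ × ℕ → ℕ → WeakDualBall CDelta))
  obtain ⟨Γ, hΓ, hsurj⟩ := PolishSpace.exists_nat_nat_continuous_surjective
    ((ℕ → CDelta) × (ℕ → WeakDualBall CDelta) × (ℕ × ℚ × ℕ → ℕ → WeakDualBall CDelta))
  let d : (ℕ → ℕ) → ℕ → CDelta := fun y => (Γ y).1
  let g : (ℕ → ℕ) → ℕ → WeakDualBall CDelta := fun y => (Γ y).2.1
  let f : (ℕ → ℕ) → ℕ × ℚ × ℕ → ℕ → WeakDualBall CDelta := fun y => (Γ y).2.2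
  have hd : ∀ n, Continuous fun y => d y n := fun n => by fun_prop
  have hg : ∀ n, Continuous fun y => g y n := fun n => by fun_prop
  have hf : ∀ t i, Continuous fun y => f y t i := fun t i => by fun_prop
  let q : ℕ → CDelta := TopologicalSpace.denseSeq CDelta
  have hq : DenseRange q := TopologicalSpace.denseRange_denseSeq CDelta
  have hmeet : ∀ j k : ℕ, Measurable fun z : SB × (ℕ → ℕ) =>
      (((z.1.1 : Submodule ℝ CDelta) : Set CDelta) ∩ ball (q j) (1 / ((k : ℝ) + 1))).Nonempty :=
    fun j k => (SB.measurable_inter_nonempty isOpen_ball).comp measurable_fst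
  have hdist : ∀ n j k : ℕ, Measurable fun z : SB × (ℕ → ℕ) =>
      dist (d z.2 n) (q j) < 1 / ((k : ℝ) + 1) := fun n j k =>
    measurableSet_setOfPred.1 <| measurableSet_lt
      (((hd n).dist continuous_const).measurable.comp measurable_snd) measurable_const
  refine ⟨{z | (∀ n, d z.2 n ∈ z.1.1) ∧
    (∀ j k : ℕ,
      (((z.1.1 : Submodule ℝ CDelta) : Set CDelta) ∩ ball (q j) (1 / ((k : ℝ) + 1))).Nonempty →
        ∃ n, dist (d z.2 n) (q j) < 1 / ((k : ℝ) + 1)) ∧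
    IsPAUSCode p (d z.2) (fun n => (g z.2 n).toDual) fun t i => (f z.2 t i).toDual},
    measurableSet_setOfPred.2 (.and (.forall fun n => ?_) (.and (.forall fun j => .forall fun k =>
      .imp (hmeet j k) (.exists fun n => hdist n j k))
      ((measurable_isPAUSCode p hd hg hf).comp measurable_snd))), ?_⟩
  · have hmem : ∀ z : SB × (ℕ → ℕ), d z.2 n ∈ z.1.1 ↔ ∀ k : ℕ, ∃ j,
        dist (d z.2 n) (q j) < 1 / ((k : ℝ) + 1) ∧
          (((z.1.1 : Submodule ℝ CDelta) : Set CDelta) ∩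
            ball (q j) (1 / ((k : ℝ) + 1))).Nonempty :=
      fun z => mem_iff_forall_exists_ball hq z.1.2 _
    simp only [hmem]
    exact .forall fun k => .exists fun j => (hdist n j k).and (hmeet j k)
  · ext F
    constructor
    · intro hF
      have hD := TopologicalSpace.denseRange_denseSeq (F.1 : Submodule ℝ CDelta)
      set D := TopologicalSpace.denseSeq (F.1 : Submodule ℝ CDelta)
      obtain ⟨g₀, f₀, hg₀, hf₀, hcode⟩ := PAUSable.exists_isPAUSCode hF hD
      choose g₁ hg₁ using fun n => WeakDualBall.exists_toDual_extension F.1 (hg₀ n)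
      choose f₁ hf₁ using fun t i => WeakDualBall.exists_toDual_extension F.1 (hf₀ t i)
      obtain ⟨y, hy⟩ := hsurj (fun n => (D n : CDelta), g₁, f₁)
      refine ⟨(F, y), ?_, rfl⟩
      simp only [mem_ofPred_eq, d, g, f, hy]
      exact ⟨fun n => (D n).2, (denseRange_iff_forall_ball hq D).1 hD,
        (isPAUSCode_coe_iff hg₁ hf₁).2 hcode⟩
    · rintro ⟨⟨F, y⟩, ⟨h1, h2, h3⟩, rfl⟩
      let D : ℕ → (F.1 : Submodule ℝ CDelta) := fun n => ⟨d y n, h1 n⟩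
      have hD : DenseRange D := (denseRange_iff_forall_ball hq D).2 h2
      refine IsPAUSCode.pausable (d := D)
        (g := fun n => (g y n).toDual.comp (F.1 : Submodule ℝ CDelta).subtypeL)
        (f := fun t i => (f y t i).toDual.comp (F.1 : Submodule ℝ CDelta).subtypeL)
        (zero_lt_one.trans hp) hD (fun n => ?_)
        ((isPAUSCode_coe_iff (fun _ _ => rfl) fun _ _ _ => rfl).1 h3)
      refine ContinuousLinearMap.opNorm_le_bound _ zero_le_one fun x => ?_
      exact (g y n).toDual.le_of_opNorm_le (g y n).norm_toDual_le x
end
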